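/- arXiv:1603.07528 — 9 statements merged into one kernel-verified Lean document; each statement's English description precedes it below -/
import Mathlib

section
/- For every z ∈ ℝ∖{−η, 0, ϑ}, the function h_q is differentiable at z and satisfies the first-order ODE κ·z·h_q′(z) + h_q(z)·( κ + (σ²/2)z² − μz − λp·z/(η+z) + λ(1−p)·z/(ϑ−z) − q ) = 0. -/
open Real MeasureTheory Filter Topology

/-- Logarithmic differentiation of `|f| ^ a` where `f` does not vanish. -/
theorem HasDerivAt.abs_rpow_const {f : ℝ → ℝ} {f' x : ℝ} (hf : HasDerivAt f f' x)
    (hx : f x ≠ 0) (a : ℝ) :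
    HasDerivAt (fun y => |f y| ^ a) (|f x| ^ a * (f' / f x * a)) x := by
  have abs_rpow_eq : ∀ y, f y ≠ 0 → |f y| ^ a = Real.exp (Real.log (f y) * a) := fun y hy => by
    rw [Real.rpow_def_of_pos (abs_pos.mpr hy), Real.log_abs]
  rw [abs_rpow_eq x hx]
  refine ((hf.log hx).mul_const a).exp.congr_of_eventuallyEq ?_
  filter_upwards [hf.continuousAt.eventually_ne hx] with y hy using abs_rpow_eq y hy

/-- For every `z ∈ ℝ \ {-η, 0, ϑ}`, the modulus function `h_q` is
differentiable at `z` and satisfies the first-order ODE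
`κ z h_q'(z) + h_q(z) (κ + (σ²/2)z² − μz − λp z/(η+z) + λ(1−p) z/(ϑ−z) − q) = 0`. -/
theorem stmt0 (κ μ σ lam p η ϑ q : ℝ)
    (hκ : 0 < κ) (hσ : 0 < σ) (hlam : 0 < lam) (hp : 0 < p) (hp1 : p < 1)
    (hη : 0 < η) (hϑ : 0 < ϑ) (hq : 0 < q)
    (h : ℝ → ℝ)
    (hdef : ∀ z : ℝ, h z =
      |z| ^ (q / κ - 1) * Real.exp (-σ ^ 2 * z ^ 2 / (4 * κ) + μ * z / κ)
        * |η + z| ^ (lam * p / κ) * |z - ϑ| ^ (lam * (1 - p) / κ)) :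
    ∀ z : ℝ, z ≠ -η → z ≠ 0 → z ≠ ϑ →
      DifferentiableAt ℝ h z ∧
      κ * z * deriv h z
        + h z * (κ + σ ^ 2 / 2 * z ^ 2 - μ * z - lam * p * z / (η + z)
            + lam * (1 - p) * z / (ϑ - z) - q) = 0 := by
  intro z hzη hz0 hzϑ
  have hη' : η + z ≠ 0 := fun H => hzη (by linarith)
  have hϑ' : z - ϑ ≠ 0 := sub_ne_zero.mpr hzϑ
  have hexp : HasDerivAt (fun z : ℝ => -σ ^ 2 * z ^ 2 / (4 * κ) + μ * z / κ)
      (-σ ^ 2 * (2 * z) / (4 * κ) + μ / κ) z := by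
    have hsq : HasDerivAt (fun z : ℝ => z ^ 2) (2 * z) z := by simpa using hasDerivAt_pow 2 z
    have hlin : HasDerivAt (fun z : ℝ => μ * z / κ) (μ / κ) z := by
      simpa using ((hasDerivAt_id z).const_mul μ).div_const κ
    exact ((hsq.const_mul (-σ ^ 2)).div_const (4 * κ)).add hlin
  have hderiv := ((((hasDerivAt_id z).abs_rpow_const hz0 (q / κ - 1)).mul hexp.exp).mul
    (((hasDerivAt_id z).const_add η).abs_rpow_const hη' (lam * p / κ))).mul
    (((hasDerivAt_id z).sub_const ϑ).abs_rpow_const hϑ' (lam * (1 - p) / κ))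
  have hh : HasDerivAt h (h z * ((q / κ - 1) / z + (-σ ^ 2 * (2 * z) / (4 * κ) + μ / κ)
      + lam * p / κ / (η + z) + lam * (1 - p) / κ / (z - ϑ))) z := by
    rw [hdef z]
    refine (hderiv.congr_of_eventuallyEq (Eventually.of_forall hdef)).congr_deriv ?_
    simp only [id, Pi.mul_apply]
    ring
  refine ⟨hh.differentiableAt, ?_⟩
  rw [hh.deriv, ← neg_sub z ϑ]
  field_simp
  ring
end

section
/- Integration by parts identity: for every x ∈ ℝ and every i ∈ {1,2,3,4}, κ·x·∫_{Γ_i} z·h_q(z)·e^{−xz} dz = κ·∫_{Γ_i} ( z·h_q′(z) + h_q(z) )·e^{−xz} dz, where both integrals converge absolutely. -/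
open Real MeasureTheory Filter Topology

theorem integrable_abs_rpow_mul_exp_neg_sq {s : ℝ} (hs : -1 < s) :
    Integrable (fun z : ℝ => |z| ^ s * exp (-1 * z ^ 2)) := by
  have hIoi : IntegrableOn (fun z : ℝ => |z| ^ s * exp (-1 * z ^ 2)) (Set.Ioi 0) :=
    (integrableOn_rpow_mul_exp_neg_mul_sq one_pos hs).congr_fun
      (fun z (hz : 0 < z) => by simp only [abs_of_pos hz]) measurableSet_Ioi
  have hIic : IntegrableOn (fun z : ℝ => |z| ^ s * exp (-1 * z ^ 2)) (Set.Iic 0) := by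
    have hneg : MeasurableEmbedding fun x : ℝ => -x := (Homeomorph.neg ℝ).measurableEmbedding
    rw [← Measure.map_neg_eq_self (volume : Measure ℝ),
      hneg.integrableOn_map_iff]
    simpa [Function.comp_def, integrableOn_Ici_iff_integrableOn_Ioi] using hIoi
  simpa only [← integrableOn_univ, ← Set.Iic_union_Ioi (a := (0 : ℝ))] using hIic.union hIoi

theorem locallyIntegrable_abs_sub_rpow {s : ℝ} (hs : -1 < s) (p : ℝ) :
    LocallyIntegrable (fun z : ℝ => |z - p| ^ s) := by
  have h := ((integrable_abs_rpow_mul_exp_neg_sq hs).comp_sub_right p).locallyIntegrable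
  have hc : Continuous fun z : ℝ => exp ((z - p) ^ 2) := by fun_prop
  refine (h.mul_continuous hc).congr (ae_of_all _ fun z => ?_)
  simp only [mul_assoc, ← exp_add]
  simp

theorem integrableAtFilter_nhds_of_eq_abs_sub_rpow_mul {s : ℝ} (hs : -1 < s) (p : ℝ)
    {f g : ℝ → ℝ} {u : Set ℝ} (hu : IsOpen u) (hg : ContinuousOn g u)
    (hfg : ∀ z, f z = |z - p| ^ s * g z) {z : ℝ} (hz : z ∈ u) : IntegrableAtFilter f (𝓝 z) := by
  have h := ((locallyIntegrable_abs_sub_rpow hs p).locallyIntegrableOn u).mul_continuousOn hg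
    hu.isLocallyClosed z hz
  rwa [hu.nhdsWithin_eq hz, ← funext hfg] at h

theorem continuousOn_abs_sub_rpow (s p : ℝ) {u : Set ℝ} (hu : p ∉ u) :
    ContinuousOn (fun z : ℝ => |z - p| ^ s) u :=
  ContinuousOn.rpow_const (by fun_prop) fun z hz =>
    Or.inl (abs_ne_zero.2 (sub_ne_zero.2 (ne_of_mem_of_not_mem hz hu)))

theorem eventually_cocompact_abs_sub_rpow_mul_exp_le_one {ε : ℝ} (hε : 0 < ε) (s p : ℝ) :
    ∀ᶠ z in cocompact ℝ, |z - p| ^ s * exp (-ε * (z - p) ^ 2) ≤ 1 :=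
  (((tendsto_rpow_abs_mul_exp_neg_mul_sq_cocompact hε s).comp
    (Homeomorph.subRight p).isClosedEmbedding.tendsto_cocompact).eventually_lt_const
      one_pos).mono fun _ h => h.le

theorem integrable_abs_sub_rpow_mul_three_mul_gaussian {p₁ p₂ p₃ : ℝ} (h₁₂ : p₁ ≠ p₂)
    (h₁₃ : p₁ ≠ p₃) (h₂₃ : p₂ ≠ p₃) {s₁ s₂ s₃ : ℝ} (h₁ : -1 < s₁) (h₂ : -1 < s₂) (h₃ : -1 < s₃)
    {α : ℝ} (hα : 0 < α) (β : ℝ) :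
    Integrable fun z : ℝ =>
      |z - p₁| ^ s₁ * |z - p₂| ^ s₂ * |z - p₃| ^ s₃ * exp (-α * z ^ 2 + β * z) := by
  have hexp (u : Set ℝ) : ContinuousOn (fun z : ℝ => exp (-α * z ^ 2 + β * z)) u := by fun_prop
  have hopen (a b : ℝ) : IsOpen ({a, b}ᶜ : Set ℝ) := (Set.toFinite _).isClosed.isOpen_compl
  have hcont {a b s t : ℝ} : ContinuousOn
      (fun z : ℝ => |z - a| ^ s * |z - b| ^ t * exp (-α * z ^ 2 + β * z)) {a, b}ᶜ :=
    ((continuousOn_abs_sub_rpow s a (by simp)).mul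
      (continuousOn_abs_sub_rpow t b (by simp))).mul (hexp _)
  have hloc : LocallyIntegrable fun z : ℝ =>
      |z - p₁| ^ s₁ * |z - p₂| ^ s₂ * |z - p₃| ^ s₃ * exp (-α * z ^ 2 + β * z) := by
    intro z
    by_cases hz₂ : z = p₂
    · exact integrableAtFilter_nhds_of_eq_abs_sub_rpow_mul h₂ p₂ (hopen p₁ p₃)
        (hcont (s := s₁) (t := s₃)) (fun y => by ring) (by simp [hz₂, h₁₂.symm, h₂₃])
    by_cases hz₃ : z = p₃
    · exact integrableAtFilter_nhds_of_eq_abs_sub_rpow_mul h₃ p₃ (hopen p₁ p₂)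
        (hcont (s := s₁) (t := s₂)) (fun y => by ring) (by simp [hz₃, h₁₃.symm, h₂₃.symm])
    · exact integrableAtFilter_nhds_of_eq_abs_sub_rpow_mul h₁ p₁ (hopen p₂ p₃)
        (hcont (s := s₂) (t := s₃)) (fun y => by ring) (by simp [hz₂, hz₃])
  obtain ⟨ε, hε, rfl⟩ : ∃ ε : ℝ, 0 < ε ∧ 8 * ε = α := ⟨α / 8, by positivity, by ring⟩
  refine hloc.integrable_of_isBigO_cocompact (g := fun z : ℝ => exp (-ε * z ^ 2)) ?_
    ((integrable_exp_neg_mul_sq hε).integrableAtFilter _)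
  set b : ℝ := β - 2 * ε * (p₁ + p₂ + p₃) with hb
  set C : ℝ := exp (ε * (p₁ ^ 2 + p₂ ^ 2 + p₃ ^ 2) + b ^ 2 / (16 * ε)) with hC
  refine Asymptotics.IsBigO.of_bound C ?_
  filter_upwards [eventually_cocompact_abs_sub_rpow_mul_exp_le_one hε s₁ p₁,
    eventually_cocompact_abs_sub_rpow_mul_exp_le_one hε s₂ p₂,
    eventually_cocompact_abs_sub_rpow_mul_exp_le_one hε s₃ p₃] with z e₁ e₂ e₃
  rw [Real.norm_of_nonneg (by positivity), Real.norm_of_nonneg (by positivity)]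
  have hquad : -(8 * ε) * z ^ 2 + β * z ≤ -ε * (z - p₁) ^ 2 + -ε * (z - p₂) ^ 2
      + -ε * (z - p₃) ^ 2 + (ε * (p₁ ^ 2 + p₂ ^ 2 + p₃ ^ 2) + b ^ 2 / (16 * ε) + -ε * z ^ 2) := by
    have hsq : 0 ≤ 4 * ε * (z - b / (8 * ε)) ^ 2 := by positivity
    have : 4 * ε * (z - b / (8 * ε)) ^ 2 = 4 * ε * z ^ 2 - b * z + b ^ 2 / (16 * ε) := by
      field_simp
      ring
    rw [this, hb] at hsq
    rw [hb]
    linarith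
  calc |z - p₁| ^ s₁ * |z - p₂| ^ s₂ * |z - p₃| ^ s₃ * exp (-(8 * ε) * z ^ 2 + β * z)
      ≤ |z - p₁| ^ s₁ * |z - p₂| ^ s₂ * |z - p₃| ^ s₃ * exp (-ε * (z - p₁) ^ 2
          + -ε * (z - p₂) ^ 2 + -ε * (z - p₃) ^ 2
          + (ε * (p₁ ^ 2 + p₂ ^ 2 + p₃ ^ 2) + b ^ 2 / (16 * ε) + -ε * z ^ 2)) := by gcongr
    _ = (|z - p₁| ^ s₁ * exp (-ε * (z - p₁) ^ 2)) * (|z - p₂| ^ s₂ * exp (-ε * (z - p₂) ^ 2))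
          * (|z - p₃| ^ s₃ * exp (-ε * (z - p₃) ^ 2)) * (C * exp (-ε * z ^ 2)) := by
      rw [hC]
      simp only [exp_add]
      ring
    _ ≤ 1 * 1 * 1 * (C * exp (-ε * z ^ 2)) := by gcongr
    _ = C * exp (-ε * z ^ 2) := by ring

theorem hasDerivAt_abs_sub_rpow {z p : ℝ} (hz : z ≠ p) (s : ℝ) :
    HasDerivAt (fun z : ℝ => |z - p| ^ s) (|z - p| ^ s * (s / (z - p))) z := by
  have hzp : z - p ≠ 0 := sub_ne_zero.2 hz
  have hrw {y : ℝ} (hy : y ≠ p) : |y - p| ^ s = exp (log (y - p) * s) := by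
    rw [rpow_def_of_pos (abs_pos.2 (sub_ne_zero.2 hy)), log_abs]
  have hd := ((((hasDerivAt_id z).sub_const p).log hzp).mul_const s).exp
  simp only [id] at hd
  rw [hrw hz]
  refine (hd.congr_of_eventuallyEq ?_).congr_deriv (by ring)
  filter_upwards [isOpen_ne.mem_nhds hz] with y hy using hrw hy

theorem setIntegral_eq_zero_of_hasDerivAt_of_integrable {G G' : ℝ → ℝ} (hG : Continuous G)
    (hint : Integrable G) (hint' : Integrable G') {a b c : ℝ} (hab : a ≤ b) (hbc : b ≤ c)
    (ha : G a = 0) (hb : G b = 0) (hc : G c = 0)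
    (hderiv : ∀ z, z ≠ a → z ≠ b → z ≠ c → HasDerivAt G (G' z) z) {Γ : Set ℝ}
    (hΓ : Γ ∈ ({Set.Ioo b c, Set.Ioi c, Set.Ioo a b, Set.Iio a} : Set (Set ℝ))) :
    ∫ z in Γ, G' z = 0 := by
  rcases hΓ with rfl | rfl | rfl | rfl
  · rw [← integral_Ioc_eq_integral_Ioo, ← intervalIntegral.integral_of_le hbc,
      intervalIntegral.integral_eq_sub_of_hasDerivAt_of_le hbc hG.continuousOn
        (fun z hz => hderiv z (hab.trans_lt hz.1).ne' hz.1.ne' hz.2.ne) hint'.intervalIntegrable,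
      hb, hc, sub_zero]
  · have hd : ∀ z ∈ Set.Ioi c, HasDerivAt G (G' z) z := fun z (hz : c < z) =>
      hderiv z ((hab.trans hbc).trans_lt hz).ne' (hbc.trans_lt hz).ne' hz.ne'
    rw [integral_Ioi_of_hasDerivAt_of_tendsto hG.continuousWithinAt hd hint'.integrableOn
      (tendsto_zero_of_hasDerivAt_of_integrableOn_Ioi hd hint'.integrableOn hint.integrableOn),
      hc, sub_zero]
  · rw [← integral_Ioc_eq_integral_Ioo, ← intervalIntegral.integral_of_le hab,
      intervalIntegral.integral_eq_sub_of_hasDerivAt_of_le hab hG.continuousOn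
        (fun z hz => hderiv z hz.1.ne' hz.2.ne (hz.2.trans_le hbc).ne) hint'.intervalIntegrable,
      ha, hb, sub_zero]
  · have hd : ∀ z ∈ Set.Iio a, HasDerivAt G (G' z) z := fun z (hz : z < a) =>
      hderiv z hz.ne (hz.trans_le hab).ne (hz.trans_le (hab.trans hbc)).ne
    have hd' : ∀ z ∈ Set.Iic (a - 1), HasDerivAt G (G' z) z := fun z (hz : z ≤ a - 1) =>
      hd z (show z < a by linarith)
    rw [← integral_Iic_eq_integral_Iio,
      integral_Iic_of_hasDerivAt_of_tendsto hG.continuousWithinAt hd hint'.integrableOn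
        (tendsto_zero_of_hasDerivAt_of_integrableOn_Iic hd' hint'.integrableOn hint.integrableOn),
      ha, sub_zero]

theorem continuous_mul_abs_rpow_sub_one {a : ℝ} (ha : 0 < a) :
    Continuous fun z : ℝ => z * |z| ^ (a - 1) := by
  refine continuous_iff_continuousAt.2 fun z => ?_
  rcases eq_or_ne z 0 with rfl | hz
  · have hnorm (y : ℝ) : ‖y * |y| ^ (a - 1)‖ = |y| ^ a := by
      rcases eq_or_ne y 0 with rfl | hy
      · simp [ha.ne']
      · rw [norm_mul, norm_eq_abs, norm_of_nonneg (by positivity),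
          rpow_sub_one (abs_ne_zero.2 hy), mul_div_cancel₀ _ (abs_ne_zero.2 hy)]
    have hc : Continuous fun y : ℝ => |y| ^ a := continuous_abs.rpow_const fun _ => Or.inr ha.le
    rw [ContinuousAt, zero_mul, tendsto_zero_iff_norm_tendsto_zero]
    simp only [hnorm]
    simpa [ha.ne'] using hc.tendsto 0
  · exact continuousAt_id.mul (continuous_abs.continuousAt.rpow_const (Or.inl (abs_ne_zero.2 hz)))

theorem integral_by_parts_abs_rpow_mul_gaussian {a b c l r α ν : ℝ} (ha : 0 < a) (hb : 0 < b)
    (hc : 0 < c) (hl : l < 0) (hr : 0 < r) (hα : 0 < α) {h : ℝ → ℝ}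
    (hdef : ∀ z, h z =
      |z| ^ (a - 1) * |z - l| ^ b * |z - r| ^ c * exp (-α * z ^ 2 + ν * z)) (x : ℝ)
    {Γ : Set ℝ} (hΓ : Γ ∈ ({Set.Ioo 0 r, Set.Ioi r, Set.Ioo l 0, Set.Iio l} : Set (Set ℝ))) :
    IntegrableOn (fun z : ℝ => z * h z * exp (-x * z)) Γ ∧
    IntegrableOn (fun z : ℝ => (z * deriv h z + h z) * exp (-x * z)) Γ ∧
    x * ∫ z in Γ, z * h z * exp (-x * z)
      = ∫ z in Γ, (z * deriv h z + h z) * exp (-x * z) := by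
  have hrpow {y : ℝ} (hy : y ≠ 0) (s : ℝ) : |y| ^ (s - 1) * |y| = |y| ^ s := by
    rw [rpow_sub_one (abs_ne_zero.2 hy), div_mul_cancel₀ _ (abs_ne_zero.2 hy)]
  have hW {s t u : ℝ} (hs : -1 < s) (ht : -1 < t) (hu : -1 < u) : Integrable fun z : ℝ =>
      |z| ^ s * |z - l| ^ t * |z - r| ^ u * exp (-α * z ^ 2 + (ν - x) * z) := by
    simpa using integrable_abs_sub_rpow_mul_three_mul_gaussian hl.ne' hr.ne (hl.trans hr).ne
      hs ht hu hα (ν - x)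
  have hexp (z : ℝ) : h z * exp (-x * z)
      = |z| ^ (a - 1) * |z - l| ^ b * |z - r| ^ c * exp (-α * z ^ 2 + (ν - x) * z) := by
    rw [hdef, mul_assoc, ← exp_add]
    ring_nf
  have hpos (z : ℝ) : 0 ≤ h z * exp (-x * z) := by rw [hexp]; positivity
  have hmeas : Measurable fun z => h z * exp (-x * z) := by
    simp only [hexp]
    fun_prop
  have hae : ∀ᵐ z : ℝ, z ≠ 0 ∧ z ≠ l ∧ z ≠ r := by
    have hne (p : ℝ) : ∀ᵐ z : ℝ, z ≠ p := compl_mem_ae_iff.2 (measure_singleton p)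
    exact (hne 0).and ((hne l).and (hne r))
  have hI₀ : Integrable fun z => h z * exp (-x * z) := by
    simpa only [hexp] using hW (s := a - 1) (by linarith) (by linarith) (by linarith)
  have hIf {s t u : ℝ} (hs : -1 < s) (ht : -1 < t) (hu : -1 < u) {f : ℝ → ℝ} (hf : Measurable f)
      (heq : ∀ z, z ≠ 0 → z - l ≠ 0 → z - r ≠ 0 →
        |z| ^ s * |z - l| ^ t * |z - r| ^ u = |f z| * (|z| ^ (a - 1) * |z - l| ^ b * |z - r| ^ c)) :
      Integrable fun z => f z * (h z * exp (-x * z)) := by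
    refine (hW hs ht hu).congr' (hf.mul hmeas).aestronglyMeasurable ?_
    filter_upwards [hae] with z ⟨h0, hzl, hzr⟩
    rw [norm_of_nonneg (by positivity), norm_eq_abs, abs_mul, abs_of_nonneg (hpos z), hexp,
      heq z h0 (sub_ne_zero.2 hzl) (sub_ne_zero.2 hzr), mul_assoc |f z|]
  have hI₁ : Integrable fun z => z * (h z * exp (-x * z)) :=
    hIf (s := a) (t := b) (u := c) (by linarith) (by linarith) (by linarith) measurable_id
      fun z h0 _ _ => by
        rw [← hrpow h0 a]
        ring
  have hI₂ : Integrable fun z => z ^ 2 * (h z * exp (-x * z)) :=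
    hIf (s := a + 1) (t := b) (u := c) (by linarith) (by linarith) (by linarith)
      (measurable_id.pow_const 2) fun z h0 _ _ => by
        rw [← hrpow h0 (a + 1), add_sub_cancel_right, ← hrpow h0 a, abs_pow]
        ring
  have hIl : Integrable fun z => z / (z - l) * (h z * exp (-x * z)) :=
    hIf (s := a) (t := b - 1) (u := c) (by linarith) (by linarith) (by linarith)
      (measurable_id.div (measurable_id.sub_const l)) fun z h0 hzl _ => by
        rw [abs_div, ← hrpow h0 a, ← hrpow hzl b]
        field_simp
  have hIr : Integrable fun z => z / (z - r) * (h z * exp (-x * z)) :=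
    hIf (s := a) (t := b) (u := c - 1) (by linarith) (by linarith) (by linarith)
      (measurable_id.div (measurable_id.sub_const r)) fun z h0 _ hzr => by
        rw [abs_div, ← hrpow h0 a, ← hrpow hzr c]
        field_simp
  have hderiv {z : ℝ} (h0 : z ≠ 0) (hzl : z ≠ l) (hzr : z ≠ r) : HasDerivAt h
      (h z * ((a - 1) / z + b / (z - l) + c / (z - r) + (-(2 * α) * z + ν))) z := by
    have hquad : HasDerivAt (fun z : ℝ => -α * z ^ 2 + ν * z) (-(2 * α) * z + ν) z :=
      (((hasDerivAt_pow 2 z).const_mul (-α)).add ((hasDerivAt_id z).const_mul ν)).congr_deriv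
        (by norm_num; ring)
    have h₀ := hasDerivAt_abs_sub_rpow h0 (a - 1)
    simp only [sub_zero] at h₀
    have hd := ((h₀.mul (hasDerivAt_abs_sub_rpow hzl b)).mul
      (hasDerivAt_abs_sub_rpow hzr c)).mul hquad.exp
    rw [funext hdef]
    exact hd.congr_deriv (by simp only [Pi.mul_apply]; ring)
  have hG : Integrable fun z : ℝ => z * h z * exp (-x * z) := by simpa only [mul_assoc] using hI₁
  have hH : Integrable fun z : ℝ => (z * deriv h z + h z) * exp (-x * z) := by
    refine (((((hI₀.const_mul a).add (hIl.const_mul b)).add (hIr.const_mul c)).add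
      (hI₂.const_mul (-(2 * α)))).add (hI₁.const_mul ν)).congr ?_
    filter_upwards [hae] with z ⟨h0, hzl, hzr⟩
    rw [(hderiv h0 hzl hzr).deriv]
    simp only [Pi.add_apply]
    field_simp
    ring
  refine ⟨hG.integrableOn, hH.integrableOn, ?_⟩
  have hcont : Continuous fun z : ℝ => z * h z * exp (-x * z) := by
    have hrpow_cont {s : ℝ} (hs : 0 < s) (p : ℝ) : Continuous fun z : ℝ => |z - p| ^ s :=
      (continuous_id.sub continuous_const).abs.rpow_const fun _ => Or.inr hs.le
    have hexp_cont : Continuous fun z : ℝ => exp (-α * z ^ 2 + (ν - x) * z) := by fun_prop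
    refine ((((continuous_mul_abs_rpow_sub_one ha).mul (hrpow_cont hb l)).mul
      (hrpow_cont hc r)).mul hexp_cont).congr fun z => ?_
    rw [mul_assoc z, hexp]
    simp only [Pi.mul_apply]
    ring
  have hzero := setIntegral_eq_zero_of_hasDerivAt_of_integrable hcont hG
    (hH.sub (hG.const_mul x)) hl.le hr.le (by simp [hdef, hb.ne']) (by simp)
    (by simp [hdef, hc.ne']) (fun z hzl h0 hzr => ?_) hΓ
  · simp only [Pi.sub_apply] at hzero
    rw [integral_sub hH.integrableOn (hG.const_mul x).integrableOn, integral_const_mul] at hzero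
    linarith
  · have he : HasDerivAt (fun z : ℝ => exp (-x * z)) (exp (-x * z) * -x) z := by
      simpa using ((hasDerivAt_id z).const_mul (-x)).exp
    have hd := hderiv h0 hzl hzr
    refine (((hasDerivAt_id z).mul hd.differentiableAt.hasDerivAt).mul he).congr_deriv ?_
    simp only [Pi.mul_apply, Pi.sub_apply, id]
    ring

/-- Integration by parts identity: for every `x ∈ ℝ` and each of the four
intervals `Γ₁=(0,ϑ)`, `Γ₂=(ϑ,∞)`, `Γ₃=(−η,0)`, `Γ₄=(−∞,−η)`,
`κ x ∫_{Γ} z h_q(z) e^{−xz} dz = κ ∫_{Γ} (z h_q'(z) + h_q(z)) e^{−xz} dz`,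
where both integrals converge absolutely. -/
theorem stmt4 (κ μ σ lam p η ϑ q : ℝ)
    (hκ : 0 < κ) (hσ : 0 < σ) (hlam : 0 < lam) (hp : 0 < p) (hp1 : p < 1)
    (hη : 0 < η) (hϑ : 0 < ϑ) (hq : 0 < q)
    (h : ℝ → ℝ)
    (hdef : ∀ z : ℝ, h z =
      |z| ^ (q / κ - 1) * Real.exp (-σ ^ 2 * z ^ 2 / (4 * κ) + μ * z / κ)
        * |η + z| ^ (lam * p / κ) * |z - ϑ| ^ (lam * (1 - p) / κ)) :
    ∀ x : ℝ,
      ∀ Γ ∈ ({Set.Ioo 0 ϑ, Set.Ioi ϑ, Set.Ioo (-η) 0, Set.Iio (-η)} : Set (Set ℝ)),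
        MeasureTheory.IntegrableOn (fun z : ℝ => z * h z * Real.exp (-x * z)) Γ ∧
        MeasureTheory.IntegrableOn
          (fun z : ℝ => (z * deriv h z + h z) * Real.exp (-x * z)) Γ ∧
        κ * x * ∫ z in Γ, z * h z * Real.exp (-x * z)
          = κ * ∫ z in Γ, (z * deriv h z + h z) * Real.exp (-x * z) := by
  intro x Γ hΓ
  obtain ⟨h₁, h₂, h₃⟩ := integral_by_parts_abs_rpow_mul_gaussian (h := h) (a := q / κ)
    (b := lam * p / κ) (c := lam * (1 - p) / κ) (l := -η) (r := ϑ) (α := σ ^ 2 / (4 * κ))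
    (ν := μ / κ) (by positivity) (by positivity)
    (div_pos (mul_pos hlam (sub_pos.2 hp1)) hκ) (by linarith) hϑ (by positivity)
    (fun z => by
      rw [hdef, show -σ ^ 2 * z ^ 2 / (4 * κ) + μ * z / κ
        = -(σ ^ 2 / (4 * κ)) * z ^ 2 + μ / κ * z by ring, sub_neg_eq_add, add_comm η z]
      ring) x hΓ
  exact ⟨h₁, h₂, by rw [mul_assoc, h₃]⟩
end

section
/- Let a ∈ ℝ and ξ ≥ 0, and define f₁ : ℝ → ℝ by f₁(x) = F₁^q(x) for x ≥ a and f₁(x) = C₁·e^{−ξ(a−x)} for x < a, where C₁ = ∫_{Γ₁} ((ϑ+ξ)/(ϑ−z))·h_q(z)·e^{−az} dz. Then f₁ solves the integro-differential equation of the jump Ornstein–Uhlenbeck generator: for every x ≥ a, (μ − κx)·(F₁^q)′(x) + (σ²/2)·(F₁^q)″(x) + λ·∫_ℝ f₁(x+y)·f_Y(y) dy − (λ+q)·F₁^q(x) = 0. -/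
open Real MeasureTheory Filter Topology

theorem integrableOn_mul_continuous {k g : ℝ → ℝ} {b : ℝ} (hk : IntegrableOn k (Set.Ioo 0 b))
    (hg : ContinuousOn g (Set.Icc 0 b)) : IntegrableOn (fun z => k z * g z) (Set.Ioo 0 b) := by
  rw [← integrableOn_Icc_iff_integrableOn_Ioo] at hk ⊢
  exact hk.mul_continuousOn hg isCompact_Icc

theorem integrableOn_rpow_mul_rpow {b s t : ℝ} (hb : 0 < b) (hs : -1 < s) (ht : -1 < t) :
    IntegrableOn (fun z => z ^ s * (b - z) ^ t) (Set.Ioo 0 b) := by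
  rw [← intervalIntegrable_iff_integrableOn_Ioo_of_le hb.le]
  refine IntervalIntegrable.trans (b := b / 2) ?_ ?_
  · refine (intervalIntegral.intervalIntegrable_rpow' hs).mul_continuousOn ?_
    refine ContinuousOn.rpow_const (by fun_prop) fun z hz => Or.inl ?_
    rw [Set.uIcc_of_le (by linarith)] at hz
    linarith [hz.2]
  · refine IntervalIntegrable.continuousOn_mul ?_ ?_
    · have := (intervalIntegral.intervalIntegrable_rpow' (a := b / 2) (b := 0) ht).comp_sub_left b
      simpa [sub_half] using this
    · refine ContinuousOn.rpow_const (by fun_prop) fun z hz => Or.inl ?_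
      rw [Set.uIcc_of_le (by linarith)] at hz
      linarith [hz.1]

theorem hasDerivAt_setIntegral_mul_exp {k : ℝ → ℝ} {b : ℝ}
    (hk : IntegrableOn k (Set.Ioo 0 b)) (x : ℝ) :
    HasDerivAt (fun x => ∫ z in Set.Ioo 0 b, k z * exp (-x * z))
      (∫ z in Set.Ioo 0 b, (-z * k z) * exp (-x * z)) x := by
  have hkexp : ∀ c : ℝ, IntegrableOn (fun z => k z * exp (-c * z)) (Set.Ioo 0 b) := fun c =>
    integrableOn_mul_continuous hk (by fun_prop)
  have hkexp' : IntegrableOn (fun z => (-z * k z) * exp (-x * z)) (Set.Ioo 0 b) := by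
    refine (integrableOn_mul_continuous (g := fun z => -z * exp (-x * z)) hk
      (by fun_prop)).congr_fun (fun z _ => ?_) measurableSet_Ioo
    ring
  refine (hasDerivAt_integral_of_dominated_loc_of_deriv_le
    (F' := fun c z => (-z * k z) * exp (-c * z))
    (bound := fun z => ‖k z * (z * exp ((|x| + 1) * z))‖)
    (Metric.ball_mem_nhds x one_pos)
    (Eventually.of_forall fun c => (hkexp c).aestronglyMeasurable) (hkexp x)
    hkexp'.aestronglyMeasurable ?_ ?_ ?_).2
  · filter_upwards [ae_restrict_mem measurableSet_Ioo] with z hz c hc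
    rw [Metric.mem_ball, Real.dist_eq] at hc
    have hc' : -c ≤ |x| + 1 := by
      have := abs_lt.1 hc
      have := neg_abs_le x
      linarith
    have h1 : exp (-c * z) ≤ exp ((|x| + 1) * z) :=
      exp_le_exp.2 (mul_le_mul_of_nonneg_right hc' hz.1.le)
    simp only [norm_mul, norm_neg, Real.norm_eq_abs, abs_exp]
    calc |z| * |k z| * exp (-c * z) ≤ |z| * |k z| * exp ((|x| + 1) * z) := by gcongr
      _ = _ := by ring
  · exact (integrableOn_mul_continuous hk (by fun_prop)).norm
  · refine Eventually.of_forall fun z c _ => ?_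
    have h1 : HasDerivAt (fun c : ℝ => -c * z) (-1 * z) c := (hasDerivAt_id c).neg.mul_const z
    exact (h1.exp.const_mul (k z)).congr_deriv (by ring)

theorem setIntegral_laplace_mul {k w : ℝ → ℝ} {b M : ℝ} {S : Set ℝ} (x : ℝ)
    (hS : MeasurableSet S) (hk : IntegrableOn k (Set.Ioo 0 b)) (hw : IntegrableOn w S)
    (hM : ∀ y ∈ S, ∀ z ∈ Set.Ioo 0 b, exp (-y * z) ≤ M) :
    IntegrableOn (fun y => (∫ z in Set.Ioo 0 b, k z * exp (-(x + y) * z)) * w y) S ∧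
      ∫ y in S, (∫ z in Set.Ioo 0 b, k z * exp (-(x + y) * z)) * w y =
        ∫ z in Set.Ioo 0 b, k z * exp (-x * z) * ∫ y in S, exp (-y * z) * w y := by
  have hkx : IntegrableOn (fun z => k z * exp (-x * z)) (Set.Ioo 0 b) :=
    integrableOn_mul_continuous hk (by fun_prop)
  have hprod : Integrable (fun v : ℝ × ℝ => exp (-v.1 * v.2) *
      (w v.1 * (k v.2 * exp (-x * v.2))))
      ((volume.restrict S).prod (volume.restrict (Set.Ioo 0 b))) := by
    refine (Integrable.mul_prod hw hkx).bdd_mul (c := M) (by fun_prop) ?_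
    rw [Measure.prod_restrict]
    filter_upwards [ae_restrict_mem (hS.prod measurableSet_Ioo)] with v hv
    rw [Real.norm_eq_abs, abs_exp]
    exact hM v.1 hv.1 v.2 hv.2
  have hinner : ∀ y, (∫ z in Set.Ioo 0 b, k z * exp (-(x + y) * z)) * w y =
      ∫ z in Set.Ioo 0 b, exp (-y * z) * (w y * (k z * exp (-x * z))) := fun y => by
    rw [← integral_mul_const]
    congr 1 with z
    rw [show -(x + y) * z = -x * z + -y * z by ring, exp_add]
    ring
  simp only [hinner]
  refine ⟨hprod.integral_prod_left, ?_⟩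
  rw [integral_integral_swap hprod]
  congr 1 with z
  rw [← integral_const_mul]
  congr 1 with y
  ring

theorem setIntegral_Ioc_exp_mul {c d : ℝ} (hc : c ≤ 0) (hd : d ≠ 0) :
    ∫ y in Set.Ioc c 0, exp (d * y) = (1 - exp (d * c)) / d := by
  rw [← intervalIntegral.integral_of_le hc, intervalIntegral.integral_comp_mul_left _ hd,
    integral_exp]
  simp [div_eq_inv_mul]

/-- The jump part of the generator acts on a Laplace mixture, continued exponentially below the
level `a`, through the moment generating function of the double exponential law. -/
theorem integral_doubleExponential_laplace {k fY f₁ : ℝ → ℝ} {p η ϑ a ξ x C₁ : ℝ}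
    (hη : 0 < η) (hϑ : 0 < ϑ) (hξ : 0 ≤ ξ) (hx : a ≤ x)
    (hk : IntegrableOn k (Set.Ioo 0 ϑ))
    (hk' : IntegrableOn (fun z => k z / (ϑ - z)) (Set.Ioo 0 ϑ))
    (hfY : ∀ y : ℝ, fY y =
      if 0 < y then p * η * exp (-η * y)
      else if y < 0 then (1 - p) * ϑ * exp (ϑ * y) else 0)
    (hC₁ : C₁ = ∫ z in Set.Ioo 0 ϑ, (ϑ + ξ) / (ϑ - z) * k z * exp (-a * z))
    (hf₁ : ∀ x : ℝ, a ≤ x → f₁ x = ∫ z in Set.Ioo 0 ϑ, k z * exp (-x * z))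
    (hf₁' : ∀ x : ℝ, x < a → f₁ x = C₁ * exp (-ξ * (a - x))) :
    ∫ y : ℝ, f₁ (x + y) * fY y = ∫ z in Set.Ioo 0 ϑ,
      (k z * exp (-x * z) * (p * η / (η + z)) +
        k z / (ϑ - z) * exp (-x * z) * ((1 - p) * ϑ)) := by
  have hc : a - x ≤ 0 := by linarith
  have hsum : ϑ + ξ ≠ 0 := by positivity
  have hwp : IntegrableOn (fun y => p * η * exp (-η * y)) (Set.Ioi 0) :=
    (integrableOn_exp_mul_Ioi (by linarith) 0).const_mul _
  have hwm : IntegrableOn (fun y => (1 - p) * ϑ * exp (ϑ * y)) (Set.Ioc (a - x) 0) :=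
    ((Continuous.integrableOn_Icc (by fun_prop)).mono_set Set.Ioc_subset_Icc_self)
  obtain ⟨hPi, hP⟩ := setIntegral_laplace_mul (M := 1) x measurableSet_Ioi hk hwp (by
    intro y hy z hz
    rw [exp_le_one_iff]
    nlinarith [mul_pos (Set.mem_Ioi.1 hy) hz.1])
  obtain ⟨hQi, hQ⟩ := setIntegral_laplace_mul (M := exp ((x - a) * ϑ)) x measurableSet_Ioc
    hk hwm (by
    intro y hy z hz
    refine exp_le_exp.2 (mul_le_mul (by linarith [hy.1]) hz.2.le hz.1.le (by linarith)))
  have hRi : IntegrableOn (fun y => C₁ * (1 - p) * ϑ * exp (-ξ * (a - x)) * exp ((ϑ + ξ) * y))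
      (Set.Iic (a - x)) := (integrableOn_exp_mul_Iic (by positivity) _).const_mul _
  have hPe : Set.EqOn (fun y => (∫ z in Set.Ioo 0 ϑ, k z * exp (-(x + y) * z)) *
      (p * η * exp (-η * y))) (fun y => f₁ (x + y) * fY y) (Set.Ioi 0) := fun y hy => by
    have hy' : 0 < y := hy
    simp only [hf₁ (x + y) (by linarith), hfY y, if_pos hy']
  have hQe : Set.EqOn (fun y => (∫ z in Set.Ioo 0 ϑ, k z * exp (-(x + y) * z)) *
      ((1 - p) * ϑ * exp (ϑ * y))) (fun y => f₁ (x + y) * fY y) (Set.Ioo (a - x) 0) :=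
    fun y hy => by
    simp only [hf₁ (x + y) (by linarith [hy.1]), hfY y, if_neg hy.2.not_gt, if_pos hy.2]
  have hRe : Set.EqOn (fun y => C₁ * (1 - p) * ϑ * exp (-ξ * (a - x)) * exp ((ϑ + ξ) * y))
      (fun y => f₁ (x + y) * fY y) (Set.Iio (a - x)) := fun y hy => by
    have hy' : y < a - x := hy
    have hy0 : y < 0 := by linarith
    simp only [hf₁' (x + y) (by linarith), hfY y, if_neg hy0.not_gt, if_pos hy0]
    rw [show -ξ * (a - (x + y)) = -ξ * (a - x) + ξ * y by ring, exp_add, add_mul, exp_add]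
    ring
  have hP' : IntegrableOn (fun y => f₁ (x + y) * fY y) (Set.Ioi 0) :=
    hPi.congr_fun hPe measurableSet_Ioi
  have hQ' : IntegrableOn (fun y => f₁ (x + y) * fY y) (Set.Ioc (a - x) 0) := by
    rw [integrableOn_Ioc_iff_integrableOn_Ioo] at hQi ⊢
    exact hQi.congr_fun hQe measurableSet_Ioo
  have hR' : IntegrableOn (fun y => f₁ (x + y) * fY y) (Set.Iic (a - x)) := by
    rw [integrableOn_Iic_iff_integrableOn_Iio] at hRi ⊢
    exact hRi.congr_fun hRe measurableSet_Iio
  have hu : Set.Ioc (a - x) 0 ∪ Set.Ioi 0 = Set.Ioi (a - x) := Set.Ioc_union_Ioi_eq_Ioi hc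
  have hdis : Disjoint (Set.Ioc (a - x) 0) (Set.Ioi (0 : ℝ)) :=
    Set.disjoint_left.2 fun y hy hy' => not_lt.2 hy.2 hy'
  rw [← intervalIntegral.integral_Iic_add_Ioi hR' (hu ▸ hQ'.union hP'), ← hu,
    setIntegral_union hdis measurableSet_Ioi hQ' hP',
    ← setIntegral_congr_fun measurableSet_Ioi hPe, hP,
    integral_Ioc_eq_integral_Ioo, ← setIntegral_congr_fun measurableSet_Ioo hQe,
    ← integral_Ioc_eq_integral_Ioo, hQ,
    integral_Iic_eq_integral_Iio, ← setIntegral_congr_fun measurableSet_Iio hRe,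
    ← integral_Iic_eq_integral_Iio, integral_const_mul, integral_exp_mul_Iic (by positivity)]
  have hz0 : ∀ z ∈ Set.Ioo 0 ϑ, ϑ - z ≠ 0 := fun z hz => (sub_pos.2 hz.2).ne'
  have hPz : ∀ z ∈ Set.Ioo 0 ϑ, ∫ y in Set.Ioi 0, exp (-y * z) * (p * η * exp (-η * y)) =
      p * η / (η + z) := fun z hz => by
    have hne : η + z ≠ 0 := by linarith [hz.1]
    have : ∀ y, exp (-y * z) * (p * η * exp (-η * y)) = p * η * exp (-(η + z) * y) := fun y => by
      rw [show -(η + z) * y = -y * z + -η * y by ring, exp_add]; ring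
    simp only [this]
    rw [integral_const_mul, integral_exp_mul_Ioi (by linarith [hz.1])]
    simp only [mul_zero, exp_zero]
    rw [neg_div_neg_eq, mul_one_div]
  have hQz : ∀ z ∈ Set.Ioo 0 ϑ, ∫ y in Set.Ioc (a - x) 0,
      exp (-y * z) * ((1 - p) * ϑ * exp (ϑ * y)) =
      (1 - p) * ϑ * ((1 - exp ((ϑ - z) * (a - x))) / (ϑ - z)) := fun z hz => by
    rw [← setIntegral_Ioc_exp_mul hc (hz0 z hz), ← integral_const_mul]
    congr 1 with y
    rw [show (ϑ - z) * y = -y * z + ϑ * y by ring, exp_add]; ring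
  have hCe : C₁ * (1 - p) * ϑ * exp (-ξ * (a - x)) * (exp ((ϑ + ξ) * (a - x)) / (ϑ + ξ)) =
      ∫ z in Set.Ioo 0 ϑ, k z / (ϑ - z) * exp (-x * z) *
        ((1 - p) * ϑ * exp ((ϑ - z) * (a - x))) := by
    rw [hC₁, show exp ((ϑ + ξ) * (a - x)) = exp (ϑ * (a - x)) * exp (ξ * (a - x)) by
      rw [← exp_add]; ring_nf]
    have h1 : exp (-ξ * (a - x)) * exp (ξ * (a - x)) = 1 := by
      rw [← exp_add, ← exp_zero]; ring_nf
    calc _ = (∫ z in Set.Ioo 0 ϑ, (ϑ + ξ) / (ϑ - z) * k z * exp (-a * z)) *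
          ((1 - p) * ϑ * exp (ϑ * (a - x)) / (ϑ + ξ)) *
          (exp (-ξ * (a - x)) * exp (ξ * (a - x))) := by ring
      _ = _ := by
        rw [h1, mul_one, ← integral_mul_const]
        congr 1 with z
        have : exp (-x * z) * exp ((ϑ - z) * (a - x)) = exp (-a * z) * exp (ϑ * (a - x)) := by
          rw [← exp_add, ← exp_add]; ring_nf
        calc _ = k z / (ϑ - z) * ((1 - p) * ϑ) * (exp (-a * z) * exp (ϑ * (a - x))) *
              ((ϑ + ξ) / (ϑ + ξ)) := by ring
          _ = _ := by rw [div_self hsum, ← this]; ring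
  have hPc : IntegrableOn (fun z => k z * exp (-x * z) * (p * η / (η + z))) (Set.Ioo 0 ϑ) := by
    refine integrableOn_mul_continuous (integrableOn_mul_continuous hk (by fun_prop)) ?_
    refine ContinuousOn.div (by fun_prop) (by fun_prop) fun z hz => ?_
    linarith [hz.1]
  have hk'x : IntegrableOn (fun z => k z / (ϑ - z) * exp (-x * z)) (Set.Ioo 0 ϑ) :=
    integrableOn_mul_continuous hk' (by fun_prop)
  have hPI : ∫ z in Set.Ioo 0 ϑ, k z * exp (-x * z) *
      ∫ y in Set.Ioi 0, exp (-y * z) * (p * η * exp (-η * y)) =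
      ∫ z in Set.Ioo 0 ϑ, k z * exp (-x * z) * (p * η / (η + z)) :=
    setIntegral_congr_fun measurableSet_Ioo fun z hz => by simp only [hPz z hz]
  have hQI : ∫ z in Set.Ioo 0 ϑ, k z * exp (-x * z) *
      ∫ y in Set.Ioc (a - x) 0, exp (-y * z) * ((1 - p) * ϑ * exp (ϑ * y)) =
      ∫ z in Set.Ioo 0 ϑ, k z / (ϑ - z) * exp (-x * z) *
        ((1 - p) * ϑ * (1 - exp ((ϑ - z) * (a - x)))) :=
    setIntegral_congr_fun measurableSet_Ioo fun z hz => by simp only [hQz z hz]; ring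
  rw [hCe, hPI, hQI, integral_add hPc (hk'x.mul_const _), ← add_assoc, ← integral_add, add_comm]
  · congr 2 with z
    ring
  · exact integrableOn_mul_continuous hk'x (by fun_prop)
  · exact integrableOn_mul_continuous hk'x (by fun_prop)

/-- With `f₁(x) = F₁^q(x)` for `x ≥ a` and `f₁(x) = C₁ e^{−ξ(a−x)}` for
`x < a`, where `C₁ = ∫_{Γ₁} ((ϑ+ξ)/(ϑ−z)) h_q(z) e^{−az} dz` and `Γ₁ = (0,ϑ)`, the
function `f₁` solves the integro-differential equation of the jump OU generator:
for every `x ≥ a`,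
`(μ − κx)(F₁^q)'(x) + (σ²/2)(F₁^q)''(x) + λ ∫_ℝ f₁(x+y) f_Y(y) dy − (λ+q) F₁^q(x) = 0`. -/
theorem stmt6 (κ μ σ lam p η ϑ q a ξ : ℝ)
    (hκ : 0 < κ) (hσ : 0 < σ) (hlam : 0 < lam) (hp : 0 < p) (hp1 : p < 1)
    (hη : 0 < η) (hϑ : 0 < ϑ) (hq : 0 < q) (hξ : 0 ≤ ξ)
    (h : ℝ → ℝ)
    (hdef : ∀ z : ℝ, h z =
      |z| ^ (q / κ - 1) * Real.exp (-σ ^ 2 * z ^ 2 / (4 * κ) + μ * z / κ)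
        * |η + z| ^ (lam * p / κ) * |z - ϑ| ^ (lam * (1 - p) / κ))
    (fY : ℝ → ℝ)
    (hfY : ∀ y : ℝ, fY y =
      if 0 < y then p * η * Real.exp (-η * y)
      else if y < 0 then (1 - p) * ϑ * Real.exp (ϑ * y) else 0)
    (F₁ : ℝ → ℝ)
    (hF₁ : ∀ x : ℝ, F₁ x = ∫ z in Set.Ioo 0 ϑ, h z * Real.exp (-x * z))
    (C₁ : ℝ)
    (hC₁ : C₁ = ∫ z in Set.Ioo 0 ϑ, (ϑ + ξ) / (ϑ - z) * h z * Real.exp (-a * z))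
    (f₁ : ℝ → ℝ)
    (hf₁ : ∀ x : ℝ, a ≤ x → f₁ x = F₁ x)
    (hf₁' : ∀ x : ℝ, x < a → f₁ x = C₁ * Real.exp (-ξ * (a - x))) :
    ∀ x : ℝ, a ≤ x →
      (μ - κ * x) * deriv F₁ x + σ ^ 2 / 2 * deriv (deriv F₁) x
        + lam * (∫ y : ℝ, f₁ (x + y) * fY y) - (lam + q) * F₁ x = 0 := by
  have hα : 0 < q / κ := by positivity
  have hγ : 0 < lam * p / κ := by positivity
  have hβ : 0 < lam * (1 - p) / κ := by
    have : 0 < 1 - p := by linarith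
    positivity
  set α := q / κ with hαdef
  set γ := lam * p / κ with hγdef
  set β := lam * (1 - p) / κ with hβdef
  have hqα : q = κ * α := by rw [hαdef]; field_simp
  have hpγ : lam * p = κ * γ := by rw [hγdef]; field_simp
  have hpβ : lam * (1 - p) = κ * β := by rw [hβdef]; field_simp
  let E : ℝ → ℝ := fun z => exp (-σ ^ 2 * z ^ 2 / (4 * κ) + μ * z / κ) * (η + z) ^ γ
  have hEc : Continuous E :=
    (by fun_prop : Continuous fun z : ℝ => exp (-σ ^ 2 * z ^ 2 / (4 * κ) + μ * z / κ)).mul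
      ((continuous_const.add continuous_id).rpow_const fun _ => Or.inr hγ.le)
  have hhE : ∀ z ∈ Set.Ioo 0 ϑ, h z = z ^ (α - 1) * (ϑ - z) ^ (β - 1) * (E z * (ϑ - z)) := by
    intro z hz
    have h1 : 0 < ϑ - z := sub_pos.2 hz.2
    rw [hdef z, abs_of_pos hz.1, abs_of_pos (add_pos hη hz.1), abs_sub_comm, abs_of_pos h1,
      rpow_sub_one h1.ne']
    simp only [E]
    field_simp
  have hw := integrableOn_rpow_mul_rpow (s := α - 1) (t := β - 1) hϑ (by linarith) (by linarith)
  have hk : IntegrableOn h (Set.Ioo 0 ϑ) :=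
    (integrableOn_mul_continuous hw (g := fun z => E z * (ϑ - z)) (by fun_prop)).congr_fun
      (fun z hz => (hhE z hz).symm) measurableSet_Ioo
  have hk' : IntegrableOn (fun z => h z / (ϑ - z)) (Set.Ioo 0 ϑ) :=
    (integrableOn_mul_continuous hw (g := E) (by fun_prop)).congr_fun
      (fun z hz => by
        have h1 : 0 < ϑ - z := sub_pos.2 hz.2
        simp only [hhE z hz]
        field_simp) measurableSet_Ioo
  have hz : ∀ k : ℝ → ℝ, IntegrableOn k (Set.Ioo 0 ϑ) →
      IntegrableOn (fun z => -z * k z) (Set.Ioo 0 ϑ) := fun k hk =>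
    (integrableOn_mul_continuous (g := fun z => -z) hk (by fun_prop)).congr_fun
      (fun z _ => mul_comm _ _) measurableSet_Ioo
  have hF : F₁ = fun x => ∫ z in Set.Ioo 0 ϑ, h z * exp (-x * z) := funext hF₁
  have hd1 : deriv F₁ = fun x => ∫ z in Set.Ioo 0 ϑ, (-z * h z) * exp (-x * z) := by
    rw [hF]; exact funext fun x => (hasDerivAt_setIntegral_mul_exp hk x).deriv
  have hd2 : deriv (deriv F₁) =
      fun x => ∫ z in Set.Ioo 0 ϑ, (-z * (-z * h z)) * exp (-x * z) := by
    rw [hd1]; exact funext fun x => (hasDerivAt_setIntegral_mul_exp (hz h hk) x).deriv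
  intro x hx
  have hexp : ∀ k : ℝ → ℝ, IntegrableOn k (Set.Ioo 0 ϑ) →
      IntegrableOn (fun z => k z * exp (-x * z)) (Set.Ioo 0 ϑ) := fun k hk =>
    integrableOn_mul_continuous hk (by fun_prop)
  have hI0 := hexp _ hk
  have hI1 := hexp _ (hz _ hk)
  have hI2 := hexp _ (hz _ (hz _ hk))
  have hI3 : IntegrableOn (fun z => h z * exp (-x * z) * (p * η / (η + z)) +
      h z / (ϑ - z) * exp (-x * z) * ((1 - p) * ϑ)) (Set.Ioo 0 ϑ) := by
    refine (integrableOn_mul_continuous hI0 ?_).add ((hexp _ hk').mul_const _)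
    refine ContinuousOn.div (by fun_prop) (by fun_prop) fun z hz => ?_
    linarith [hz.1]
  rw [integral_doubleExponential_laplace hη hϑ hξ hx hk hk' hfY hC₁
    (fun y hy => (hf₁ y hy).trans (hF₁ y)) hf₁', hd2, hd1, hF₁ x]
  simp only []
  have hI12 := (hI1.const_mul (μ - κ * x)).add (hI2.const_mul (σ ^ 2 / 2))
  have hI123 := hI12.add (hI3.const_mul lam)
  have hI := hI123.sub (hI0.const_mul (lam + q))
  rw [← integral_const_mul, ← integral_const_mul, ← integral_const_mul, ← integral_const_mul,
    ← integral_add' (hI1.const_mul _) (hI2.const_mul _), ← integral_add' hI12 (hI3.const_mul _),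
    ← integral_sub' hI123 (hI0.const_mul _)]
  let G : ℝ → ℝ := fun z => -κ * (z ^ α * (ϑ - z) ^ β * E z * exp (-x * z))
  have hGc : Continuous G := by
    have h1 : Continuous fun z : ℝ => z ^ α := continuous_id.rpow_const fun _ => Or.inr hα.le
    have h2 : Continuous fun z : ℝ => (ϑ - z) ^ β :=
      (continuous_const.sub continuous_id).rpow_const fun _ => Or.inr hβ.le
    fun_prop
  have hG0 : G 0 = 0 := by simp [G, zero_rpow hα.ne']
  have hGϑ : G ϑ = 0 := by simp [G, zero_rpow hβ.ne']
  rw [← integral_Ioc_eq_integral_Ioo, ← intervalIntegral.integral_of_le hϑ.le,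
    intervalIntegral.integral_eq_sub_of_hasDerivAt_of_le hϑ.le hGc.continuousOn ?_
      ((intervalIntegrable_iff_integrableOn_Ioo_of_le hϑ.le).2 hI), hG0, hGϑ, sub_zero]
  intro z hz
  have h0 : 0 < z := hz.1
  have h1 : 0 < ϑ - z := sub_pos.2 hz.2
  have h2 : 0 < η + z := add_pos hη h0
  have d1 : HasDerivAt (fun z : ℝ => z ^ α) (α * z ^ (α - 1)) z :=
    hasDerivAt_rpow_const (Or.inl h0.ne')
  have d2 : HasDerivAt (fun z : ℝ => (ϑ - z) ^ β) (-1 * β * (ϑ - z) ^ (β - 1)) z :=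
    ((hasDerivAt_id z).const_sub ϑ).rpow_const (Or.inl h1.ne')
  have d3 : HasDerivAt (fun z : ℝ => (η + z) ^ γ) (1 * γ * (η + z) ^ (γ - 1)) z :=
    ((hasDerivAt_id z).const_add η).rpow_const (Or.inl h2.ne')
  have d4 : HasDerivAt (fun z : ℝ => -σ ^ 2 * z ^ 2 / (4 * κ) + μ * z / κ)
      (-σ ^ 2 * (2 * z) / (4 * κ) + μ / κ) z := by
    have e1 := (((hasDerivAt_pow 2 z).const_mul (-σ ^ 2)).div_const (4 * κ)).add
      (((hasDerivAt_id z).const_mul μ).div_const κ)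
    exact e1.congr_deriv (by simp)
  have d5 : HasDerivAt (fun z : ℝ => exp (-x * z)) (exp (-x * z) * (-x * 1)) z :=
    ((hasDerivAt_id z).const_mul (-x)).exp
  refine ((((d1.mul d2).mul (d4.exp.mul d3)).mul d5).const_mul (-κ)).congr_deriv ?_
  have hhz : h z = z ^ α / z * (ϑ - z) ^ β *
      (exp (-σ ^ 2 * z ^ 2 / (4 * κ) + μ * z / κ) * (η + z) ^ γ) := by
    rw [hhE z hz, rpow_sub_one h0.ne', rpow_sub_one h1.ne']
    simp only [E]
    field_simp
  simp only [Pi.mul_apply, Pi.add_apply, Pi.sub_apply, hhz, rpow_sub_one h0.ne',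
    rpow_sub_one h1.ne', rpow_sub_one h2.ne']
  generalize exp (-σ ^ 2 * z ^ 2 / (4 * κ) + μ * z / κ) = e
  generalize exp (-x * z) = e'
  generalize z ^ α = A
  generalize (ϑ - z) ^ β = B
  generalize (η + z) ^ γ = D
  have hlam' : lam = κ * (γ + β) := by linear_combination hpγ + hpβ
  have hjump : ∀ X Y W : ℝ, lam * (X * (p * η / Y) + W * ((1 - p) * ϑ)) =
      X * (κ * γ * η / Y) + W * (κ * β * ϑ) := fun X Y W => by
    linear_combination X * η / Y * hpγ + W * ϑ * hpβ
  rw [hjump, hlam', hqα]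
  field_simp
  ring
end

section
/- Let a ∈ ℝ and ξ ≥ 0, and define f₂ : ℝ → ℝ by f₂(x) = F₂^q(x) for x ≥ a and f₂(x) = C₂·e^{−ξ(a−x)} for x < a, where C₂ = −∫_{Γ₂} ((ϑ+ξ)/(z−ϑ))·h_q(z)·e^{−az} dz. Then for every x ≥ a, (μ − κx)·(F₂^q)′(x) + (σ²/2)·(F₂^q)″(x) + λ·∫_ℝ f₂(x+y)·f_Y(y) dy − (λ+q)·F₂^q(x) = 0, all integrals converging absolutely. -/
open Real MeasureTheory Filter Topology

/-- The weight `|z|^α exp(-c z² + b z) |η + z|^β |z - ϑ|^γ`. -/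
noncomputable def gaussPowWeight (α β γ c η ϑ b z : ℝ) : ℝ :=
  |z| ^ α * exp (-c * z ^ 2 + b * z) * |η + z| ^ β * |z - ϑ| ^ γ

section Weight

variable {α β γ c η ϑ : ℝ}

lemma gaussPowWeight_nonneg (b z : ℝ) : 0 ≤ gaussPowWeight α β γ c η ϑ b z := by
  unfold gaussPowWeight; positivity

lemma measurable_gaussPowWeight (b : ℝ) : Measurable (gaussPowWeight α β γ c η ϑ b) := by
  unfold gaussPowWeight; fun_prop

lemma gaussPowWeight_mul_exp (b x z : ℝ) :
    gaussPowWeight α β γ c η ϑ b z * exp (-x * z) = gaussPowWeight α β γ c η ϑ (b - x) z := by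
  have : exp (-c * z ^ 2 + (b - x) * z) = exp (-c * z ^ 2 + b * z) * exp (-x * z) := by
    rw [← exp_add]; ring_nf
  unfold gaussPowWeight
  rw [this]; ring

lemma exists_rpow_le_mul_exp (s : ℝ) {d : ℝ} (hd : 0 < d) :
    ∃ C, 0 ≤ C ∧ ∀ z, d ≤ z → z ^ s ≤ C * exp z := by
  have ht := tendsto_rpow_mul_exp_neg_mul_atTop_nhds_zero s 1 one_pos
  obtain ⟨N, hN⟩ := eventually_atTop.1 (ht.eventually (gt_mem_nhds one_pos))
  have hc : ContinuousOn (fun z : ℝ => z ^ s * exp (-1 * z)) (Set.Icc d N) := by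
    refine ContinuousOn.mul (ContinuousOn.rpow_const continuousOn_id ?_) (by fun_prop)
    intro z hz
    exact Or.inl (hd.trans_le hz.1).ne'
  obtain ⟨C, hC⟩ := isCompact_Icc.exists_bound_of_continuousOn hc
  refine ⟨max C 1, by positivity, fun z hz => ?_⟩
  have h1 : z ^ s * exp (-1 * z) ≤ max C 1 := by
    rcases le_total z N with h | h
    · exact ((le_abs_self _).trans (hC z ⟨hz, h⟩)).trans (le_max_left _ _)
    · exact (hN z h).le.trans (le_max_right _ _)
  have h2 : z ^ s = z ^ s * exp (-1 * z) * exp z := by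
    rw [mul_assoc, ← exp_add]; simp
  rw [h2]
  gcongr

lemma integrableOn_sub_rpow_mul_exp_neg (hγ : 0 < γ) :
    IntegrableOn (fun z => exp (-(z - ϑ)) * (z - ϑ) ^ (γ - 1)) (Set.Ioi ϑ) := by
  have h := (GammaIntegral_convergent hγ).integrable_indicator measurableSet_Ioi
  have h' := h.comp_sub_right ϑ
  rw [← integrable_indicator_iff measurableSet_Ioi]
  refine h'.congr (ae_of_all _ fun z => ?_)
  simp [Set.indicator, sub_pos]

lemma integrableOn_pow_mul_gaussPowWeight_div (hc : 0 < c) (hη : 0 < η) (hϑ : 0 < ϑ) (hγ : 0 < γ)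
    (b : ℝ) (n : ℕ) :
    IntegrableOn (fun z => z ^ n * (gaussPowWeight α β γ c η ϑ b z / (z - ϑ))) (Set.Ioi ϑ) := by
  obtain ⟨A, hA0, hA⟩ := exists_rpow_le_mul_exp α hϑ
  obtain ⟨B, hB0, hB⟩ := exists_rpow_le_mul_exp β (d := η + ϑ) (by positivity)
  obtain ⟨D, hD0, hD⟩ := exists_rpow_le_mul_exp n hϑ
  set K := exp ((b + 4) ^ 2 / (4 * c) + η - ϑ)
  refine ((integrableOn_sub_rpow_mul_exp_neg (ϑ := ϑ) hγ).const_mul (D * A * B * K)).mono'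
    ?_ ?_
  · have := measurable_gaussPowWeight (α := α) (β := β) (γ := γ) (c := c) (η := η) (ϑ := ϑ) b
    exact Measurable.aestronglyMeasurable (by fun_prop)
  refine (ae_restrict_iff' measurableSet_Ioi).2 (ae_of_all _ fun z (hz : ϑ < z) => ?_)
  have hz0 : 0 < z := hϑ.trans hz
  have hz1 : 0 < z - ϑ := sub_pos.2 hz
  have e1 : gaussPowWeight α β γ c η ϑ b z / (z - ϑ)
      = z ^ α * exp (-c * z ^ 2 + b * z) * (η + z) ^ β * (z - ϑ) ^ (γ - 1) := by
    rw [gaussPowWeight, abs_of_pos hz0, abs_of_pos hz1, abs_of_pos (by positivity),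
      rpow_sub_one hz1.ne']
    ring
  rw [e1, Real.norm_of_nonneg (by positivity)]
  have hAz := hA z hz.le
  have hBz := hB (η + z) (by linarith)
  have hDz : z ^ n ≤ D * exp z := by simpa using hD z hz.le
  have hexp : exp z * exp z * exp (η + z) * exp (-c * z ^ 2 + b * z) ≤ K * exp (-(z - ϑ)) := by
    simp only [K, ← exp_add]
    apply exp_le_exp.2
    have : (b + 4) * z - c * z ^ 2 ≤ (b + 4) ^ 2 / (4 * c) := by
      rw [le_div_iff₀ (by positivity)]
      nlinarith [sq_nonneg (2 * c * z - (b + 4))]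
    linarith
  calc z ^ n * (z ^ α * exp (-c * z ^ 2 + b * z) * (η + z) ^ β * (z - ϑ) ^ (γ - 1))
      ≤ (D * exp z) * ((A * exp z) * exp (-c * z ^ 2 + b * z) * (B * exp (η + z))
          * (z - ϑ) ^ (γ - 1)) := by gcongr
    _ = D * A * B * (exp z * exp z * exp (η + z) * exp (-c * z ^ 2 + b * z))
          * (z - ϑ) ^ (γ - 1) := by ring
    _ ≤ D * A * B * (K * exp (-(z - ϑ))) * (z - ϑ) ^ (γ - 1) := by gcongr
    _ = _ := by ring

lemma integrableOn_pow_mul_gaussPowWeight (hc : 0 < c) (hη : 0 < η) (hϑ : 0 < ϑ) (hγ : 0 < γ)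
    (b : ℝ) (n : ℕ) :
    IntegrableOn (fun z => z ^ n * gaussPowWeight α β γ c η ϑ b z) (Set.Ioi ϑ) := by
  have h1 := integrableOn_pow_mul_gaussPowWeight_div (α := α) (β := β) hc hη hϑ hγ b (n + 1)
  have h0 := integrableOn_pow_mul_gaussPowWeight_div (α := α) (β := β) hc hη hϑ hγ b n
  refine (h1.sub (h0.const_mul ϑ)).congr_fun (fun z (hz : ϑ < z) => ?_) measurableSet_Ioi
  have : z - ϑ ≠ 0 := (sub_pos.2 hz).ne'
  simp only [Pi.sub_apply]
  field_simp
  ring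

lemma integrableOn_gaussPowWeight_div_add (hc : 0 < c) (hη : 0 < η) (hϑ : 0 < ϑ) (hγ : 0 < γ)
    (b : ℝ) :
    IntegrableOn (fun z => gaussPowWeight α β γ c η ϑ b z / (η + z)) (Set.Ioi ϑ) := by
  have h0 := integrableOn_pow_mul_gaussPowWeight (α := α) (β := β) hc hη hϑ hγ b 0
  have hm := measurable_gaussPowWeight (α := α) (β := β) (γ := γ) (c := c) (η := η) (ϑ := ϑ) b
  refine (h0.const_mul η⁻¹).mono' (Measurable.aestronglyMeasurable (by fun_prop)) ?_
  refine (ae_restrict_iff' measurableSet_Ioi).2 (ae_of_all _ fun z (hz : ϑ < z) => ?_)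
  have hw := gaussPowWeight_nonneg (α := α) (β := β) (γ := γ) (c := c) (η := η) (ϑ := ϑ) b z
  have hz0 : 0 < z := hϑ.trans hz
  rw [Real.norm_of_nonneg (by positivity), pow_zero, one_mul, div_eq_inv_mul]
  gcongr
  linarith

lemma hasDerivAt_mul_gaussPowWeight (hη : 0 < η) (hϑ : 0 < ϑ) (b : ℝ) {z : ℝ} (hz : ϑ < z) :
    HasDerivAt (fun z => z * gaussPowWeight α β γ c η ϑ b z)
      ((1 + α + β + γ) * gaussPowWeight α β γ c η ϑ b z
        + b * (z * gaussPowWeight α β γ c η ϑ b z)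
        - 2 * c * (z ^ 2 * gaussPowWeight α β γ c η ϑ b z)
        - β * η * (gaussPowWeight α β γ c η ϑ b z / (η + z))
        + γ * ϑ * (gaussPowWeight α β γ c η ϑ b z / (z - ϑ))) z := by
  have hz0 : 0 < z := hϑ.trans hz
  have hz1 : 0 < z - ϑ := sub_pos.2 hz
  have hz2 : 0 < η + z := by positivity
  have key : HasDerivAt (fun z => z * (z ^ α * exp (-c * z ^ 2 + b * z) * (η + z) ^ β
      * (z - ϑ) ^ γ)) _ z :=
    (hasDerivAt_id z).mul (((((hasDerivAt_id z).rpow_const (p := α) (Or.inl hz0.ne')).mul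
      ((((hasDerivAt_pow 2 z).const_mul (-c)).add ((hasDerivAt_id z).const_mul b)).exp)).mul
      (((hasDerivAt_id z).const_add η).rpow_const (p := β) (Or.inl hz2.ne'))).mul
      (((hasDerivAt_id z).sub_const ϑ).rpow_const (p := γ) (Or.inl hz1.ne')))
  have heq : (fun z => z * gaussPowWeight α β γ c η ϑ b z) =ᶠ[𝓝 z]
      (fun z => z * (z ^ α * exp (-c * z ^ 2 + b * z) * (η + z) ^ β * (z - ϑ) ^ γ)) := by
    filter_upwards [lt_mem_nhds hz] with y hy
    have : 0 < y := hϑ.trans hy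
    rw [gaussPowWeight, abs_of_pos this, abs_of_pos (sub_pos.2 hy), abs_of_pos (by positivity)]
  refine (key.congr_of_eventuallyEq heq).congr_deriv ?_
  rw [gaussPowWeight, abs_of_pos hz0, abs_of_pos hz1, abs_of_pos hz2]
  simp only [id, rpow_sub_one hz0.ne', rpow_sub_one hz1.ne', rpow_sub_one hz2.ne',
    Pi.mul_apply, Pi.add_apply]
  field_simp
  ring

lemma integral_gaussPowWeight_relation (hc : 0 < c) (hη : 0 < η) (hϑ : 0 < ϑ) (hγ : 0 < γ)
    (b : ℝ) :
    (1 + α + β + γ) * (∫ z in Set.Ioi ϑ, gaussPowWeight α β γ c η ϑ b z)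
      + b * (∫ z in Set.Ioi ϑ, z * gaussPowWeight α β γ c η ϑ b z)
      - 2 * c * (∫ z in Set.Ioi ϑ, z ^ 2 * gaussPowWeight α β γ c η ϑ b z)
      - β * η * (∫ z in Set.Ioi ϑ, gaussPowWeight α β γ c η ϑ b z / (η + z))
      + γ * ϑ * (∫ z in Set.Ioi ϑ, gaussPowWeight α β γ c η ϑ b z / (z - ϑ)) = 0 := by
  have i0 : IntegrableOn (fun z => gaussPowWeight α β γ c η ϑ b z) (Set.Ioi ϑ) := by
    simpa using integrableOn_pow_mul_gaussPowWeight (α := α) (β := β) hc hη hϑ hγ b 0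
  have i1 : IntegrableOn (fun z => z * gaussPowWeight α β γ c η ϑ b z) (Set.Ioi ϑ) := by
    simpa using integrableOn_pow_mul_gaussPowWeight (α := α) (β := β) hc hη hϑ hγ b 1
  have i2 := integrableOn_pow_mul_gaussPowWeight (α := α) (β := β) hc hη hϑ hγ b 2
  have i3 := integrableOn_gaussPowWeight_div_add (α := α) (β := β) hc hη hϑ hγ b
  have i4 : IntegrableOn (fun z => gaussPowWeight α β γ c η ϑ b z / (z - ϑ)) (Set.Ioi ϑ) := by
    simpa using integrableOn_pow_mul_gaussPowWeight_div (α := α) (β := β) hc hη hϑ hγ b 0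
  have j0 := i0.const_mul (1 + α + β + γ)
  have j1 := j0.add (i1.const_mul b)
  have j2 := j1.sub (i2.const_mul (2 * c))
  have j3 := j2.sub (i3.const_mul (β * η))
  have j4 := j3.add (i4.const_mul (γ * ϑ))
  simp only [Pi.add_def, Pi.sub_def] at j1 j2 j3 j4
  have hd : ∀ z ∈ Set.Ioi ϑ, HasDerivAt (fun z => z * gaussPowWeight α β γ c η ϑ b z) _ z :=
    fun z hz => hasDerivAt_mul_gaussPowWeight hη hϑ b hz
  have hcont : ContinuousWithinAt (fun z => z * gaussPowWeight α β γ c η ϑ b z)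
      (Set.Ici ϑ) ϑ := by
    apply ContinuousAt.continuousWithinAt
    unfold gaussPowWeight
    refine continuousAt_id.mul (((ContinuousAt.mul ?_ (by fun_prop)).mul ?_).mul ?_)
    · exact (by fun_prop : ContinuousAt (fun z : ℝ => |z|) ϑ).rpow_const
        (Or.inl (abs_pos.2 hϑ.ne').ne')
    · exact (by fun_prop : ContinuousAt (fun z : ℝ => |η + z|) ϑ).rpow_const
        (Or.inl (abs_pos.2 (by positivity)).ne')
    · exact (by fun_prop : ContinuousAt (fun z : ℝ => |z - ϑ|) ϑ).rpow_const (Or.inr hγ.le)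
  have h := integral_Ioi_of_hasDerivAt_of_tendsto hcont hd j4
    (tendsto_zero_of_hasDerivAt_of_integrableOn_Ioi hd j4 i1)
  rw [integral_add j3 (i4.const_mul _), integral_sub j2 (i3.const_mul _),
    integral_sub j1 (i2.const_mul _), integral_add j0 (i1.const_mul _)] at h
  simp only [integral_const_mul] at h
  rw [h]
  simp [gaussPowWeight, hγ.ne']

end Weight

lemma hasDerivAt_integral_pow_mul_exp_neg {w : ℝ → ℝ} {s : Set ℝ} (hw : ∀ z, 0 ≤ w z)
    (hm : Measurable w) (hint : ∀ x, IntegrableOn (fun z => w z * exp (-x * z)) s)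
    (n : ℕ) (x : ℝ) :
    HasDerivAt (fun x => ∫ z in s, z ^ n * (w z * exp (-x * z)))
      (-∫ z in s, z ^ (n + 1) * (w z * exp (-x * z))) x := by
  set ν : Measure ℝ := (volume.restrict s).withDensity (fun z => ENNReal.ofReal (w z))
  have hv : ∀ g : ℝ → ℝ, ∫ z, g z ∂ν = ∫ z in s, w z * g z := fun g => by
    simp only [ν]
    rw [integral_withDensity_eq_integral_toReal_smul (by fun_prop) (by simp)]
    simp [ENNReal.toReal_ofReal, hw]
  have huniv : ProbabilityTheory.integrableExpSet id ν = Set.univ := by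
    refine Set.eq_univ_of_forall fun t => ?_
    simp only [ProbabilityTheory.integrableExpSet, Set.mem_ofPred_eq, ν]
    rw [integrable_withDensity_iff_integrable_smul' (by fun_prop) (by simp)]
    simpa [ENNReal.toReal_ofReal, hw, IntegrableOn] using hint (-t)
  have h := ProbabilityTheory.hasDerivAt_integral_pow_mul_exp_real (X := id) (μ := ν) (t := -x)
    (by simp [huniv]) n
  simp only [hv, id] at h
  have h2 := h.comp x (hasDerivAt_neg x)
  convert! h2 using 1
  · ext y
    exact integral_congr_ae (ae_of_all _ fun z => by simp only; ring)
  · rw [mul_neg_one]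
    congr 1
    exact integral_congr_ae (ae_of_all _ fun z => by simp only; ring)

lemma integrable_and_integral_exp_mul_laplace {w E : ℝ → ℝ} {s t : Set ℝ} (hw : ∀ z, 0 ≤ w z)
    (hm : Measurable w) (ht : MeasurableSet t) (ρ x : ℝ)
    (hint : ∀ z ∈ t, IntegrableOn (fun y => exp ((ρ - z) * y)) s)
    (hE : ∀ z ∈ t, ∫ y in s, exp ((ρ - z) * y) = E z)
    (hG : IntegrableOn (fun z => w z * exp (-x * z) * E z) t) :
    IntegrableOn (fun y => exp (ρ * y) * ∫ z in t, w z * exp (-(x + y) * z)) s ∧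
      ∫ y in s, exp (ρ * y) * ∫ z in t, w z * exp (-(x + y) * z)
        = ∫ z in t, w z * exp (-x * z) * E z := by
  let k : ℝ → ℝ → ℝ := fun y z => w z * exp (-x * z) * exp ((ρ - z) * y)
  have hk : ∀ y, exp (ρ * y) * ∫ z in t, w z * exp (-(x + y) * z) = ∫ z in t, k y z := by
    intro y
    rw [← integral_const_mul]
    refine integral_congr_ae (ae_of_all _ fun z => ?_)
    have : exp (-(x + y) * z) * exp (ρ * y) = exp (-x * z) * exp ((ρ - z) * y) := by
      rw [← exp_add, ← exp_add]; ring_nf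
    simp only [k]
    linear_combination w z * this
  have hkE : ∀ z ∈ t, ∫ y in s, k y z = w z * exp (-x * z) * E z := fun z hz => by
    simp only [k, integral_const_mul, hE z hz]
  have hprod : Integrable (Function.uncurry k) ((volume.restrict s).prod (volume.restrict t)) := by
    rw [integrable_prod_iff' (Measurable.aestronglyMeasurable (by
      simp only [k, Function.uncurry_def]; fun_prop))]
    refine ⟨(ae_restrict_iff' ht).2 (ae_of_all _ fun z hz =>
      (hint z hz).const_mul (w z * exp (-x * z))), ?_⟩
    refine hG.congr_fun (fun z hz => ?_) ht
    have : ∀ y, ‖k y z‖ = k y z := fun y =>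
      Real.norm_of_nonneg (mul_nonneg (mul_nonneg (hw z) (exp_pos _).le) (exp_pos _).le)
    simp only [Function.uncurry_apply_pair, this, hkE z hz]
  simp only [hk]
  refine ⟨hprod.integral_prod_left, ?_⟩
  rw [integral_integral_swap hprod]
  exact setIntegral_congr_fun ht hkE

lemma setIntegral_exp_mul_Ico {r d e : ℝ} (hr : r ≠ 0) (hde : d ≤ e) :
    ∫ y in Set.Ico d e, exp (r * y) = (exp (r * e) - exp (r * d)) / r := by
  rw [integral_Ico_eq_integral_Ioc, ← intervalIntegral.integral_of_le hde,
    intervalIntegral.integral_comp_mul_left _ hr, integral_exp, smul_eq_mul]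
  ring

lemma integrable_and_integral_mul_doubleExp {w : ℝ → ℝ} {p η ϑ a ξ x C : ℝ} {f F fY : ℝ → ℝ}
    (hη : 0 < η) (hϑ : 0 < ϑ) (hξ : 0 ≤ ξ) (hw : ∀ z, 0 ≤ w z) (hm : Measurable w)
    (hfY : ∀ y : ℝ, fY y =
      if 0 < y then p * η * exp (-η * y)
      else if y < 0 then (1 - p) * ϑ * exp (ϑ * y) else 0)
    (hF : ∀ x, F x = ∫ z in Set.Ioi ϑ, w z * exp (-x * z))
    (hC : C = -((ϑ + ξ) * ∫ z in Set.Ioi ϑ, w z * exp (-a * z) / (z - ϑ)))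
    (hf : ∀ x, a ≤ x → f x = F x)
    (hf' : ∀ x, x < a → f x = C * exp (-ξ * (a - x)))
    (hint₁ : ∀ x, IntegrableOn (fun z => w z * exp (-x * z) / (z - ϑ)) (Set.Ioi ϑ))
    (hint₂ : ∀ x, IntegrableOn (fun z => w z * exp (-x * z) / (η + z)) (Set.Ioi ϑ))
    (hx : a ≤ x) :
    Integrable (fun y => f (x + y) * fY y) ∧
      ∫ y, f (x + y) * fY y
        = p * η * (∫ z in Set.Ioi ϑ, w z * exp (-x * z) / (η + z))
          - (1 - p) * ϑ * (∫ z in Set.Ioi ϑ, w z * exp (-x * z) / (z - ϑ)) := by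
  have hax : a - x ≤ 0 := by linarith
  have hϑξ : 0 < ϑ + ξ := by linarith
  -- upward jumps
  have hpos := integrable_and_integral_exp_mul_laplace (s := Set.Ioi 0) (t := Set.Ioi ϑ)
    (E := fun z => 1 / (η + z)) hw hm measurableSet_Ioi (-η) x
    (fun z (hz : ϑ < z) => integrableOn_exp_mul_Ioi (by linarith) 0)
    (fun z (hz : ϑ < z) => by
      rw [integral_exp_mul_Ioi (by linarith), show -η - z = -(η + z) by ring,
        mul_zero, exp_zero, neg_div_neg_eq])
    (by simpa only [mul_one_div] using hint₂ x)
  simp only [mul_one_div, ← hF] at hpos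
  have epos : Set.EqOn (fun y => p * η * (exp (-η * y) * F (x + y)))
      (fun y => f (x + y) * fY y) (Set.Ioi 0) := fun y (hy : 0 < y) => by
    simp only [hfY, if_pos hy, hf (x + y) (by linarith)]; ring
  have ipos := IntegrableOn.congr_fun (hpos.1.const_mul (p * η)) epos measurableSet_Ioi
  have vpos := setIntegral_congr_fun (μ := volume) measurableSet_Ioi epos
  rw [integral_const_mul, hpos.2] at vpos
  -- downward jumps that stay above the barrier
  have hsplit : Set.EqOn
      (fun z => exp (ϑ * (a - x)) * (w z * exp (-a * z) / (z - ϑ)) - w z * exp (-x * z) / (z - ϑ))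
      (fun z => w z * exp (-x * z) *
        ((exp ((ϑ - z) * 0) - exp ((ϑ - z) * (a - x))) / (ϑ - z))) (Set.Ioi ϑ) :=
    fun z (hz : ϑ < z) => by
      have e : exp (-x * z) * exp ((ϑ - z) * (a - x)) = exp (ϑ * (a - x)) * exp (-a * z) := by
        rw [← exp_add, ← exp_add]; ring_nf
      have h1 : z - ϑ ≠ 0 := by linarith
      have h2 : ϑ - z = -(z - ϑ) := by ring
      simp only [mul_zero, exp_zero]
      generalize exp ((ϑ - z) * (a - x)) = A, exp (ϑ * (a - x)) = B, exp (-x * z) = D,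
        exp (-a * z) = G at e ⊢
      rw [h2, div_neg]
      field_simp
      linear_combination (-w z) * e
  have isplit := ((hint₁ a).const_mul (exp (ϑ * (a - x)))).sub (hint₁ x)
  have hmid := integrable_and_integral_exp_mul_laplace (s := Set.Ico (a - x) 0) (t := Set.Ioi ϑ)
    hw hm measurableSet_Ioi ϑ x
    (fun z (hz : ϑ < z) => (Continuous.integrableOn_Icc (by fun_prop)).mono_set
      Set.Ico_subset_Icc_self)
    (fun z (hz : ϑ < z) => setIntegral_exp_mul_Ico (by linarith) hax)
    (IntegrableOn.congr_fun isplit hsplit measurableSet_Ioi)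
  rw [← setIntegral_congr_fun measurableSet_Ioi hsplit,
    integral_sub ((hint₁ a).const_mul _) (hint₁ x), integral_const_mul] at hmid
  simp only [← hF] at hmid
  have emid : Set.EqOn (fun y => (1 - p) * ϑ * (exp (ϑ * y) * F (x + y)))
      (fun y => f (x + y) * fY y) (Set.Ico (a - x) 0) := fun y hy => by
    simp only [hfY, if_neg hy.2.le.not_gt, if_pos hy.2, hf (x + y) (by linarith [hy.1])]; ring
  have imid := IntegrableOn.congr_fun (hmid.1.const_mul ((1 - p) * ϑ)) emid measurableSet_Ico
  have vmid := setIntegral_congr_fun (μ := volume) measurableSet_Ico emid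
  rw [integral_const_mul, hmid.2] at vmid
  -- downward jumps across the barrier
  have elow : Set.EqOn
      (fun y => (1 - p) * ϑ * C * exp (-ξ * (a - x)) * exp ((ϑ + ξ) * y))
      (fun y => f (x + y) * fY y) (Set.Iio (a - x)) := fun y (hy : y < a - x) => by
    have hy0 : y < 0 := by linarith
    have e : exp (-ξ * (a - x)) * exp ((ϑ + ξ) * y)
        = exp (-ξ * (a - (x + y))) * exp (ϑ * y) := by
      rw [← exp_add, ← exp_add]; ring_nf
    simp only [hfY, if_neg hy0.le.not_gt, if_pos hy0, hf' (x + y) (by linarith)]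
    linear_combination (1 - p) * ϑ * C * e
  have ilow := IntegrableOn.congr_fun
    (((integrableOn_exp_mul_Iic hϑξ (a - x)).mono_set Set.Iio_subset_Iic_self).const_mul
    ((1 - p) * ϑ * C * exp (-ξ * (a - x)))) elow measurableSet_Iio
  have vlow := setIntegral_congr_fun (μ := volume) measurableSet_Iio elow
  rw [integral_const_mul, ← integral_Iic_eq_integral_Iio, integral_exp_mul_Iic hϑξ] at vlow
  -- assembling the pieces
  have ineg : IntegrableOn (fun y => f (x + y) * fY y) (Set.Iio 0) := by
    rw [← Set.Iio_union_Ico_eq_Iio hax]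
    exact ilow.union imid
  have iic : IntegrableOn (fun y => f (x + y) * fY y) (Set.Iic 0) :=
    (integrableOn_Iic_iff_integrableOn_Iio enorm_ne_top).2 ineg
  have iall : Integrable (fun y => f (x + y) * fY y) := by
    rw [← integrableOn_univ, ← Set.Iic_union_Ioi (a := (0 : ℝ))]
    exact iic.union ipos
  have hdisj : Disjoint (Set.Iio (a - x)) (Set.Ico (a - x) 0) :=
    Set.disjoint_left.2 fun y h1 h2 => not_lt.2 h2.1 h1
  refine ⟨iall, ?_⟩
  rw [← setIntegral_univ, ← Set.Iic_union_Ioi (a := (0 : ℝ)),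
    setIntegral_union (Set.Iic_disjoint_Ioi le_rfl) measurableSet_Ioi iic ipos,
    integral_Iic_eq_integral_Iio, ← Set.Iio_union_Ico_eq_Iio hax,
    setIntegral_union hdisj measurableSet_Ico ilow imid, ← vpos, ← vmid, ← vlow, hC]
  have e : exp (-ξ * (a - x)) * exp ((ϑ + ξ) * (a - x)) = exp (ϑ * (a - x)) := by
    rw [← exp_add]; ring_nf
  rw [← e]
  field_simp
  ring

/-- With `f₂(x) = F₂^q(x)` for `x ≥ a` and `f₂(x) = C₂ e^{−ξ(a−x)}` for
`x < a`, where `C₂ = −∫_{Γ₂} ((ϑ+ξ)/(z−ϑ)) h_q(z) e^{−az} dz` and `Γ₂ = (ϑ,∞)`,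
for every `x ≥ a`,
`(μ − κx)(F₂^q)'(x) + (σ²/2)(F₂^q)''(x) + λ ∫_ℝ f₂(x+y) f_Y(y) dy − (λ+q) F₂^q(x) = 0`,
all integrals converging absolutely. -/
theorem stmt7 (κ μ σ lam p η ϑ q a ξ : ℝ)
    (hκ : 0 < κ) (hσ : 0 < σ) (hlam : 0 < lam) (hp : 0 < p) (hp1 : p < 1)
    (hη : 0 < η) (hϑ : 0 < ϑ) (hq : 0 < q) (hξ : 0 ≤ ξ)
    (h : ℝ → ℝ)
    (hdef : ∀ z : ℝ, h z =
      |z| ^ (q / κ - 1) * Real.exp (-σ ^ 2 * z ^ 2 / (4 * κ) + μ * z / κ)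
        * |η + z| ^ (lam * p / κ) * |z - ϑ| ^ (lam * (1 - p) / κ))
    (fY : ℝ → ℝ)
    (hfY : ∀ y : ℝ, fY y =
      if 0 < y then p * η * Real.exp (-η * y)
      else if y < 0 then (1 - p) * ϑ * Real.exp (ϑ * y) else 0)
    (F₂ : ℝ → ℝ)
    (hF₂ : ∀ x : ℝ, F₂ x = ∫ z in Set.Ioi ϑ, h z * Real.exp (-x * z))
    (C₂ : ℝ)
    (hC₂ : C₂ = -∫ z in Set.Ioi ϑ, (ϑ + ξ) / (z - ϑ) * h z * Real.exp (-a * z))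
    (f₂ : ℝ → ℝ)
    (hf₂ : ∀ x : ℝ, a ≤ x → f₂ x = F₂ x)
    (hf₂' : ∀ x : ℝ, x < a → f₂ x = C₂ * Real.exp (-ξ * (a - x))) :
    (∀ x : ℝ, MeasureTheory.IntegrableOn
        (fun z : ℝ => h z * Real.exp (-x * z)) (Set.Ioi ϑ)) ∧
    ∀ x : ℝ, a ≤ x →
      MeasureTheory.Integrable (fun y : ℝ => f₂ (x + y) * fY y) ∧
      (μ - κ * x) * deriv F₂ x + σ ^ 2 / 2 * deriv (deriv F₂) x
        + lam * (∫ y : ℝ, f₂ (x + y) * fY y) - (lam + q) * F₂ x = 0 := by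
  have hc : 0 < σ ^ 2 / (4 * κ) := by positivity
  have hγ : 0 < lam * (1 - p) / κ := div_pos (mul_pos hlam (by linarith)) hκ
  set w := gaussPowWeight (q / κ - 1) (lam * p / κ) (lam * (1 - p) / κ) (σ ^ 2 / (4 * κ)) η ϑ
    with hw
  have hh : h = w (μ / κ) := funext fun z => by
    rw [hdef, hw, gaussPowWeight]
    ring_nf
  have hexp : ∀ x z, w (μ / κ) z * exp (-x * z) = w (μ / κ - x) z :=
    fun x z => gaussPowWeight_mul_exp _ _ _
  have hnonneg : ∀ z, 0 ≤ w (μ / κ) z := gaussPowWeight_nonneg _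
  have hmeas : Measurable (w (μ / κ)) := measurable_gaussPowWeight _
  have hint : ∀ x, IntegrableOn (fun z => w (μ / κ) z * exp (-x * z)) (Set.Ioi ϑ) := fun x => by
    simpa only [hexp, pow_zero, one_mul] using!
      integrableOn_pow_mul_gaussPowWeight hc hη hϑ hγ (μ / κ - x) 0
  have hint₁ : ∀ x, IntegrableOn (fun z => w (μ / κ) z * exp (-x * z) / (z - ϑ)) (Set.Ioi ϑ) :=
    fun x => by
      simpa only [hexp, pow_zero, one_mul] using!
        integrableOn_pow_mul_gaussPowWeight_div hc hη hϑ hγ (μ / κ - x) 0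
  have hint₂ : ∀ x, IntegrableOn (fun z => w (μ / κ) z * exp (-x * z) / (η + z)) (Set.Ioi ϑ) :=
    fun x => by
      simpa only [hexp] using integrableOn_gaussPowWeight_div_add hc hη hϑ hγ (μ / κ - x)
  subst hh
  refine ⟨hint, fun x hx => ?_⟩
  have hC : C₂ = -((ϑ + ξ) * ∫ z in Set.Ioi ϑ, w (μ / κ) z * exp (-a * z) / (z - ϑ)) := by
    rw [hC₂, ← integral_const_mul]
    congr 1
    exact integral_congr_ae (ae_of_all _ fun z => by simp only; ring)
  obtain ⟨hI, hV⟩ := integrable_and_integral_mul_doubleExp hη hϑ hξ hnonneg hmeas hfY hF₂ hC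
    hf₂ hf₂' hint₁ hint₂ hx
  refine ⟨hI, ?_⟩
  have hderiv := hasDerivAt_integral_pow_mul_exp_neg hnonneg hmeas hint
  have hD1 : deriv F₂ = fun x => -∫ z in Set.Ioi ϑ, z ^ 1 * (w (μ / κ) z * exp (-x * z)) := by
    funext y
    have h0 := (hderiv 0 y).deriv
    simpa only [pow_zero, one_mul, ← hF₂, zero_add] using h0
  have hD2 : deriv (deriv F₂) x = ∫ z in Set.Ioi ϑ, z ^ 2 * (w (μ / κ) z * exp (-x * z)) := by
    rw [hD1]
    simpa using (hderiv 1 x).neg.deriv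
  have hrel := integral_gaussPowWeight_relation (α := q / κ - 1) (β := lam * p / κ) hc hη hϑ hγ
    (μ / κ - x)
  rw [← hw] at hrel
  rw [hD2, hD1, hV, hF₂]
  simp only [hexp, pow_one]
  generalize (∫ z in Set.Ioi ϑ, w (μ / κ - x) z) = M₀,
    (∫ z in Set.Ioi ϑ, z * w (μ / κ - x) z) = M₁,
    (∫ z in Set.Ioi ϑ, z ^ 2 * w (μ / κ - x) z) = M₂,
    (∫ z in Set.Ioi ϑ, w (μ / κ - x) z / (η + z)) = I₁,
    (∫ z in Set.Ioi ϑ, w (μ / κ - x) z / (z - ϑ)) = I₂ at hrel ⊢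
  field_simp at hrel
  linear_combination (-1 / 4) * hrel
end

section
/- Let c ∈ ℝ and ρ ≥ 0, and define g₁ : ℝ → ℝ by g₁(x) = F₃^q(x) for x ≤ c and g₁(x) = D₃·e^{−ρ(x−c)} for x > c, where D₃ = ∫_{Γ₃} ((η+ρ)/(η+z))·h_q(z)·e^{−cz} dz. Then for every x ≤ c, (μ − κx)·(F₃^q)′(x) + (σ²/2)·(F₃^q)″(x) + λ·∫_ℝ g₁(x+y)·f_Y(y) dy − (λ+q)·F₃^q(x) = 0. -/
open Real MeasureTheory Filter Topology


lemma integrableOn_rpow_sub_one_mul_rpow_sub_one {a b η : ℝ} (ha : 0 < a) (hb : 0 < b)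
    (hη : 0 < η) :
    IntegrableOn (fun z : ℝ => (-z) ^ (a - 1) * (η + z) ^ (b - 1)) (Set.Ioo (-η) 0) := by
  have h1 : IntervalIntegrable (fun z : ℝ => (-z) ^ (a - 1)) volume (-(η / 2)) 0 := by
    have := (intervalIntegral.intervalIntegrable_rpow' (a := η / 2) (b := 0)
      (show -1 < a - 1 by linarith)).comp_sub_left 0
    simpa using this
  have h2 : IntervalIntegrable (fun z : ℝ => (η + z) ^ (b - 1)) volume (-η) (-(η / 2)) := by
    have := (intervalIntegral.intervalIntegrable_rpow' (a := 0) (b := η / 2)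
      (show -1 < b - 1 by linarith)).comp_add_right η
    convert this using 1
    · ext z; rw [add_comm]
    · ring
    · ring
  have h3 : IntervalIntegrable (fun z : ℝ => (-z) ^ (a - 1) * (η + z) ^ (b - 1)) volume
      (-(η / 2)) 0 := by
    refine h1.mul_continuousOn ?_
    rw [Set.uIcc_of_le (by linarith)]
    intro z hz
    refine ContinuousAt.continuousWithinAt ?_
    exact (continuousAt_const.add continuousAt_id).rpow_const (Or.inl (by
      have : -(η / 2) ≤ z := hz.1; change η + z ≠ 0; linarith))
  have h4 : IntervalIntegrable (fun z : ℝ => (-z) ^ (a - 1) * (η + z) ^ (b - 1)) volume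
      (-η) (-(η / 2)) := by
    refine h2.continuousOn_mul ?_
    rw [Set.uIcc_of_le (by linarith)]
    intro z hz
    refine ContinuousAt.continuousWithinAt ?_
    exact continuousAt_neg.rpow_const (Or.inl (by
      have := hz.2; linarith))
  have h5 := h4.trans h3
  rw [intervalIntegrable_iff_integrableOn_Ioo_of_le (by linarith)] at h5
  exact h5

lemma integrableOn_mul_continuous_Ioo {w φ : ℝ → ℝ} {a b : ℝ} (hw : IntegrableOn w (Set.Ioo a b))
    (hφ : ContinuousOn φ (Set.Icc a b)) : IntegrableOn (fun z => w z * φ z) (Set.Ioo a b) :=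
  hw.mul_continuousOn_of_subset hφ measurableSet_Ioo isCompact_Icc Set.Ioo_subset_Icc_self

lemma hasDerivAt_setIntegral_mul_exp_neg_mul {w : ℝ → ℝ} {a b : ℝ}
    (hw : IntegrableOn w (Set.Ioo a b)) (x : ℝ) :
    HasDerivAt (fun x => ∫ z in Set.Ioo a b, w z * exp (-x * z))
      (∫ z in Set.Ioo a b, -z * w z * exp (-x * z)) x := by
  set R := max |a| |b|
  have hR : ∀ z ∈ Set.Ioo a b, |z| ≤ R := fun z hz =>
    abs_le_max_abs_abs hz.1.le hz.2.le
  have hexp : ∀ x : ℝ, Continuous fun z : ℝ => exp (-x * z) := fun x => by fun_prop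
  refine (hasDerivAt_integral_of_dominated_loc_of_deriv_le (s := Metric.ball x 1)
    (F := fun x z => w z * exp (-x * z)) (F' := fun x z => -z * w z * exp (-x * z))
    (bound := fun z => ‖w z‖ * (R * exp ((|x| + 1) * R)))
    (Metric.ball_mem_nhds x one_pos) ?_ ?_ ?_ ?_ ?_ ?_).2
  · exact Eventually.of_forall fun y =>
      (integrableOn_mul_continuous_Ioo hw (hexp y).continuousOn).aestronglyMeasurable
  · exact integrableOn_mul_continuous_Ioo hw (hexp x).continuousOn
  · have := (integrableOn_mul_continuous_Ioo hw
      (φ := fun z => -z * exp (-x * z)) (by fun_prop)).aestronglyMeasurable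
    refine this.congr (Eventually.of_forall fun z => ?_)
    simp only; ring
  · refine ae_restrict_of_forall_mem measurableSet_Ioo fun z hz y hy => ?_
    have hzR := hR z hz
    have hR0 : 0 ≤ R := (abs_nonneg z).trans hzR
    have hy1 : |y| ≤ |x| + 1 := by
      rw [Metric.mem_ball, Real.dist_eq] at hy
      have := abs_sub_abs_le_abs_sub y x
      linarith
    have he : exp (-y * z) ≤ exp ((|x| + 1) * R) := by
      apply exp_le_exp.2
      calc -y * z ≤ |-y * z| := le_abs_self _
        _ = |y| * |z| := by rw [abs_mul, abs_neg]
        _ ≤ _ := by gcongr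
    rw [norm_mul, norm_mul, norm_neg, Real.norm_of_nonneg (exp_pos _).le]
    calc ‖z‖ * ‖w z‖ * exp (-y * z) ≤ R * ‖w z‖ * exp ((|x| + 1) * R) := by
          gcongr
          exact hzR
      _ = _ := by ring
  · exact hw.norm.mul_const _
  · refine Eventually.of_forall fun z y _ => ?_
    have h1 : HasDerivAt (fun y : ℝ => -y * z) (-1 * z) y := (hasDerivAt_neg y).mul_const z
    convert! h1.exp.const_mul (w z) using 1
    ring

lemma setIntegral_swap_mul_of_abs_le_one {f k : ℝ → ℝ} {K : ℝ → ℝ → ℝ} {s t : Set ℝ}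
    (hs : MeasurableSet s) (ht : MeasurableSet t) (hf : IntegrableOn f s) (hk : IntegrableOn k t)
    (hK : Continuous (Function.uncurry K)) (hK1 : ∀ z ∈ s, ∀ y ∈ t, |K z y| ≤ 1) :
    IntegrableOn (fun y => ∫ z in s, f z * (k y * K z y)) t ∧
      ∫ y in t, ∫ z in s, f z * (k y * K z y) = ∫ z in s, f z * ∫ y in t, k y * K z y := by
  have hI : Integrable (Function.uncurry fun z y => f z * (k y * K z y))
      ((volume.restrict s).prod (volume.restrict t)) := by
    have h1 := Integrable.mul_prod hf hk
    refine (h1.mul_bdd (c := 1) hK.aestronglyMeasurable ?_).congr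
      (Eventually.of_forall fun v => ?_)
    · rw [Measure.prod_restrict]
      exact ae_restrict_of_forall_mem (hs.prod ht) fun v hv => hK1 v.1 hv.1 v.2 hv.2
    · simp only [Function.uncurry]; ring
  refine ⟨hI.integral_prod_right, ?_⟩
  rw [← integral_integral_swap hI]
  simp only [integral_const_mul]

lemma integral_Ioc_exp_neg_mul {r : ℝ} (hr : r ≠ 0) {T : ℝ} (hT : 0 ≤ T) :
    ∫ y in Set.Ioc 0 T, exp (-(r * y)) = (1 - exp (-(r * T))) / r := by
  rw [← intervalIntegral.integral_of_le hT]
  rw [intervalIntegral.integral_eq_sub_of_hasDerivAt (f := fun y => -exp (-(r * y)) / r)]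
  · simp; ring
  · intro y _
    have h1 : HasDerivAt (fun y : ℝ => -(r * y)) (-(r * 1)) y :=
      ((hasDerivAt_id y).const_mul r).neg
    convert! (h1.exp.neg).div_const r using 1
    field_simp
  · exact Continuous.intervalIntegrable (by fun_prop) _ _

lemma setIntegral_deriv_rpow_mul_exp_mul_rpow_eq_zero {a b η ϑ : ℝ} (ha : 0 < a) (hb : 0 < b)
    (hη : 0 < η) (hϑ : 0 < ϑ) (d A B : ℝ) :
    ∫ z in Set.Ioo (-η) 0, (-z) ^ (a - 1) * (η + z) ^ (b - 1) *
      (exp (A * z ^ 2 + B * z) * (ϑ - z) ^ d *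
        (-a * (η + z) - z * (2 * A * z + B) * (η + z) - z * b
          + z * (η + z) * d / (ϑ - z))) = 0 := by
  have hne : ∀ z ∈ Set.Icc (-η) 0, ϑ - z ≠ 0 := fun z hz => by
    have := hz.2
    linarith
  have hθ : ∀ e : ℝ, ContinuousOn (fun z : ℝ => (ϑ - z) ^ e) (Set.Icc (-η) 0) := fun e =>
    (by fun_prop : ContinuousOn (fun z : ℝ => ϑ - z) _).rpow_const fun z hz => Or.inl (hne z hz)
  have hint := integrableOn_mul_continuous_Ioo
    (integrableOn_rpow_sub_one_mul_rpow_sub_one ha hb hη)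
    (φ := fun z => exp (A * z ^ 2 + B * z) * (ϑ - z) ^ d *
        (-a * (η + z) - z * (2 * A * z + B) * (η + z) - z * b
          + z * (η + z) * d / (ϑ - z))) (by
      refine ContinuousOn.mul (ContinuousOn.mul (by fun_prop) (hθ d)) ?_
      refine ContinuousOn.add (by fun_prop) (ContinuousOn.div (by fun_prop) (by fun_prop) hne))
  rw [← integral_Ioc_eq_integral_Ioo, ← intervalIntegral.integral_of_le (by linarith)]
  rw [intervalIntegral.integral_eq_sub_of_hasDerivAt_of_le (by linarith)
    (f := fun z => (-z) ^ a * exp (A * z ^ 2 + B * z) * (η + z) ^ b * (ϑ - z) ^ d)]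
  · simp [zero_rpow ha.ne', zero_rpow hb.ne']
  · refine ContinuousOn.mul (Continuous.continuousOn ?_) (hθ d)
    refine Continuous.mul (Continuous.mul ?_ (by fun_prop)) ?_
    · exact continuous_neg.rpow_const fun _ => Or.inr ha.le
    · exact (continuous_const.add continuous_id).rpow_const fun _ => Or.inr hb.le
  · intro z hz
    have hz1 : 0 < -z := by linarith [hz.2]
    have hz2 : 0 < η + z := by linarith [hz.1]
    have hz3 : 0 < ϑ - z := by linarith
    have d1 : HasDerivAt (fun z : ℝ => (-z) ^ a) (-1 * a * (-z) ^ (a - 1)) z :=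
      (hasDerivAt_neg z).rpow_const (Or.inl hz1.ne')
    have d2 : HasDerivAt (fun z : ℝ => (η + z) ^ b) (1 * b * (η + z) ^ (b - 1)) z :=
      ((hasDerivAt_id z).const_add η).rpow_const (Or.inl hz2.ne')
    have d3 : HasDerivAt (fun z : ℝ => (ϑ - z) ^ d) (-1 * d * (ϑ - z) ^ (d - 1)) z :=
      ((hasDerivAt_id z).const_sub ϑ).rpow_const (Or.inl hz3.ne')
    have d4 : HasDerivAt (fun z : ℝ => exp (A * z ^ 2 + B * z))
        (exp (A * z ^ 2 + B * z) * (A * (2 * z) + B)) z := by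
      refine HasDerivAt.exp ?_
      have e1 : HasDerivAt (fun z : ℝ => z ^ 2) (2 * z) z := by simpa using hasDerivAt_pow 2 z
      convert! (e1.const_mul A).add ((hasDerivAt_id z).const_mul B) using 1
      ring
    convert! ((d1.mul d4).mul d2).mul d3 using 1
    have e1 : (-z) ^ a = (-z) ^ (a - 1) * (-z) := by
      rw [rpow_sub_one hz1.ne', div_mul_cancel₀ _ hz1.ne']
    have e2 : (η + z) ^ b = (η + z) ^ (b - 1) * (η + z) := by
      rw [rpow_sub_one hz2.ne', div_mul_cancel₀ _ hz2.ne']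
    simp only [Pi.mul_apply]
    rw [e1, e2, rpow_sub_one hz3.ne']
    generalize (-z) ^ (a - 1) = R1
    generalize (η + z) ^ (b - 1) = R2
    field_simp
    ring
  · rw [intervalIntegrable_iff_integrableOn_Ioo_of_le (by linarith)]
    exact hint

/-- With `g₁(x) = F₃^q(x)` for `x ≤ c` and `g₁(x) = D₃ e^{−ρ(x−c)}` for
`x > c`, where `D₃ = ∫_{Γ₃} ((η+ρ)/(η+z)) h_q(z) e^{−cz} dz` and `Γ₃ = (−η,0)`,
for every `x ≤ c`,
`(μ − κx)(F₃^q)'(x) + (σ²/2)(F₃^q)''(x) + λ ∫_ℝ g₁(x+y) f_Y(y) dy − (λ+q) F₃^q(x) = 0`. -/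
theorem stmt8 (κ μ σ lam p η ϑ q c ρ : ℝ)
    (hκ : 0 < κ) (hσ : 0 < σ) (hlam : 0 < lam) (hp : 0 < p) (hp1 : p < 1)
    (hη : 0 < η) (hϑ : 0 < ϑ) (hq : 0 < q) (hρ : 0 ≤ ρ)
    (h : ℝ → ℝ)
    (hdef : ∀ z : ℝ, h z =
      |z| ^ (q / κ - 1) * Real.exp (-σ ^ 2 * z ^ 2 / (4 * κ) + μ * z / κ)
        * |η + z| ^ (lam * p / κ) * |z - ϑ| ^ (lam * (1 - p) / κ))
    (fY : ℝ → ℝ)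
    (hfY : ∀ y : ℝ, fY y =
      if 0 < y then p * η * Real.exp (-η * y)
      else if y < 0 then (1 - p) * ϑ * Real.exp (ϑ * y) else 0)
    (F₃ : ℝ → ℝ)
    (hF₃ : ∀ x : ℝ, F₃ x = ∫ z in Set.Ioo (-η) 0, h z * Real.exp (-x * z))
    (D₃ : ℝ)
    (hD₃ : D₃ = ∫ z in Set.Ioo (-η) 0, (η + ρ) / (η + z) * h z * Real.exp (-c * z))
    (g₁ : ℝ → ℝ)
    (hg₁ : ∀ x : ℝ, x ≤ c → g₁ x = F₃ x)
    (hg₁' : ∀ x : ℝ, c < x → g₁ x = D₃ * Real.exp (-ρ * (x - c))) :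
    ∀ x : ℝ, x ≤ c →
      (μ - κ * x) * deriv F₃ x + σ ^ 2 / 2 * deriv (deriv F₃) x
        + lam * (∫ y : ℝ, g₁ (x + y) * fY y) - (lam + q) * F₃ x = 0 := by
  intro x hx
  set a := q / κ with ha_def
  set b := lam * p / κ with hb_def
  set d := lam * (1 - p) / κ with hd_def
  have ha : 0 < a := by positivity
  have hb : 0 < b := by positivity
  set w : ℝ → ℝ := fun z => h z / (η + z) with hw_def
  have hh : ∀ z ∈ Set.Ioo (-η) 0, h z = w z * (η + z) := fun z hz => by
    have : η + z ≠ 0 := by linarith [hz.1]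
    simp only [hw_def]; field_simp
  have hwS : ∀ z ∈ Set.Ioo (-η) 0, w z = (-z) ^ (a - 1) * (η + z) ^ (b - 1) *
      (exp (-(σ ^ 2 / (4 * κ)) * z ^ 2 + μ / κ * z) * (ϑ - z) ^ d) := fun z hz => by
    have h2 : 0 < η + z := by linarith [hz.1]
    simp only [hw_def]
    rw [hdef, abs_of_neg hz.2, abs_of_pos h2, abs_of_neg (by linarith [hz.2] : z - ϑ < 0),
      rpow_sub_one h2.ne', neg_sub]
    rw [show -σ ^ 2 * z ^ 2 / (4 * κ) + μ * z / κ
      = -(σ ^ 2 / (4 * κ)) * z ^ 2 + μ / κ * z by ring]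
    ring
  have hne : ∀ z ∈ Set.Icc (-η) 0, ϑ - z ≠ 0 := fun z hz => by
    have := hz.2
    linarith
  have hw : IntegrableOn w (Set.Ioo (-η) 0) := by
    refine (integrableOn_mul_continuous_Ioo
      (integrableOn_rpow_sub_one_mul_rpow_sub_one ha hb hη)
      (φ := fun z => exp (-(σ ^ 2 / (4 * κ)) * z ^ 2 + μ / κ * z) * (ϑ - z) ^ d) ?_).congr_fun
      (fun z hz => (hwS z hz).symm) measurableSet_Ioo
    refine ContinuousOn.mul (by fun_prop) ?_
    exact (by fun_prop : ContinuousOn (fun z : ℝ => ϑ - z) _).rpow_const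
      fun z hz => Or.inl (hne z hz)
  have hhi : IntegrableOn h (Set.Ioo (-η) 0) :=
    (integrableOn_mul_continuous_Ioo hw (φ := fun z => η + z) (by fun_prop)).congr_fun
      (fun z hz => (hh z hz).symm) measurableSet_Ioo
  have hF : F₃ = fun x => ∫ z in Set.Ioo (-η) 0, h z * exp (-x * z) := funext hF₃
  have hF1 : deriv F₃ = fun x => ∫ z in Set.Ioo (-η) 0, -z * h z * exp (-x * z) := by
    rw [hF]
    exact funext fun y => (hasDerivAt_setIntegral_mul_exp_neg_mul hhi y).deriv
  have hzh : IntegrableOn (fun z => -z * h z) (Set.Ioo (-η) 0) :=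
    (integrableOn_mul_continuous_Ioo hhi (φ := fun z => -z) (by fun_prop)).congr
      (Eventually.of_forall fun z => by simp only; ring)
  have hF2 : deriv (deriv F₃) x
      = ∫ z in Set.Ioo (-η) 0, -z * (-z * h z) * exp (-x * z) := by
    rw [hF1]
    exact (hasDerivAt_setIntegral_mul_exp_neg_mul hzh x).deriv
  have hhx : IntegrableOn (fun z => h z * exp (-x * z)) (Set.Ioo (-η) 0) :=
    integrableOn_mul_continuous_Ioo hhi (φ := fun z => exp (-x * z)) (by fun_prop)
  have hwx : IntegrableOn (fun z => w z * exp (-x * z)) (Set.Ioo (-η) 0) :=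
    integrableOn_mul_continuous_Ioo hw (φ := fun z => exp (-x * z)) (by fun_prop)
  set T := c - x with hT_def
  have hT : 0 ≤ T := by linarith
  -- negative jumps
  obtain ⟨iN, eN⟩ := setIntegral_swap_mul_of_abs_le_one (s := Set.Ioo (-η) 0) (t := Set.Iio 0)
    (f := fun z => h z * exp (-x * z)) (k := fun y => exp (ϑ * y)) (K := fun z y => exp (-z * y))
    measurableSet_Ioo measurableSet_Iio hhx
    ((integrableOn_exp_mul_Iic hϑ 0).mono_set Set.Iio_subset_Iic_self)
    (by simp only [Function.uncurry_def]; fun_prop) (fun z hz y hy => by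
      rw [abs_of_pos (exp_pos _), exp_le_one_iff]
      have : 0 ≤ z * y := mul_nonneg_of_nonpos_of_nonpos hz.2.le (le_of_lt hy)
      linarith)
  -- positive jumps that stay below `c`
  obtain ⟨iP, eP⟩ := setIntegral_swap_mul_of_abs_le_one (s := Set.Ioo (-η) 0) (t := Set.Ioc 0 T)
    (f := fun z => h z * exp (-x * z)) (k := fun _ => (1 : ℝ)) (K := fun z y => exp (-((η + z) * y)))
    measurableSet_Ioo measurableSet_Ioc hhx (by simp)
    (by simp only [Function.uncurry_def]; fun_prop) (fun z hz y hy => by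
      rw [abs_of_pos (exp_pos _), exp_le_one_iff]
      have : 0 ≤ (η + z) * y := mul_nonneg (by linarith [hz.1]) hy.1.le
      linarith)
  have cN : ∀ y ∈ Set.Iio (0 : ℝ), (1 - p) * ϑ *
      (∫ z in Set.Ioo (-η) 0, h z * exp (-x * z) * (exp (ϑ * y) * exp (-z * y)))
      = g₁ (x + y) * fY y := fun y hy => by
    have hy' : y < 0 := hy
    rw [hg₁ _ (by linarith), hfY, if_neg hy'.not_gt, if_pos hy', hF₃]
    rw [← integral_const_mul, ← integral_mul_const]
    refine integral_congr_ae (Eventually.of_forall fun z => ?_)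
    simp only
    rw [show -(x + y) * z = -x * z + -z * y by ring, exp_add]
    ring
  have cP : ∀ y ∈ Set.Ioc (0 : ℝ) T, p * η *
      (∫ z in Set.Ioo (-η) 0, h z * exp (-x * z) * (1 * exp (-((η + z) * y))))
      = g₁ (x + y) * fY y := fun y hy => by
    rw [hg₁ _ (by linarith [hy.2]), hfY, if_pos hy.1, hF₃]
    rw [← integral_const_mul, ← integral_mul_const]
    refine integral_congr_ae (Eventually.of_forall fun z => ?_)
    simp only
    rw [show -((η + z) * y) = -η * y + -y * z by ring,
      show -(x + y) * z = -x * z + -y * z by ring, exp_add, exp_add]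
    ring
  have cT : ∀ y ∈ Set.Ioi T, D₃ * p * η * exp (ρ * T) * exp (-(η + ρ) * y)
      = g₁ (x + y) * fY y := fun y hy => by
    have hy' : T < y := hy
    rw [hg₁' _ (by linarith), hfY, if_pos (by linarith),
      show -ρ * (x + y - c) = ρ * T + -ρ * y by rw [hT_def]; ring,
      show -(η + ρ) * y = -η * y + -ρ * y by ring, exp_add, exp_add]
    ring
  have hηρ : 0 < η + ρ := by linarith
  have jN : IntegrableOn (fun y => g₁ (x + y) * fY y) (Set.Iio 0) :=
    IntegrableOn.congr_fun (iN.const_mul _) cN measurableSet_Iio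
  have jP : IntegrableOn (fun y => g₁ (x + y) * fY y) (Set.Ioc 0 T) :=
    IntegrableOn.congr_fun (iP.const_mul _) cP measurableSet_Ioc
  have jT : IntegrableOn (fun y => g₁ (x + y) * fY y) (Set.Ioi T) :=
    IntegrableOn.congr_fun
      ((integrableOn_exp_mul_Ioi (show -(η + ρ) < 0 by linarith) T).const_mul _) cT
      measurableSet_Ioi
  have hJ : ∫ y, g₁ (x + y) * fY y
      = (1 - p) * ϑ * (∫ z in Set.Ioo (-η) 0, h z * exp (-x * z) * (1 / (ϑ - z)))
        + (p * η * (∫ z in Set.Ioo (-η) 0, h z * exp (-x * z) *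
            ((1 - exp (-((η + z) * T))) / (η + z)))
          + D₃ * p * η * exp (-η * T) / (η + ρ)) := by
    have jP' : IntegrableOn (fun y => g₁ (x + y) * fY y) (Set.Ioi 0) := by
      rw [← Set.Ioc_union_Ioi_eq_Ioi hT]
      exact jP.union jT
    rw [← intervalIntegral.integral_Iic_add_Ioi
      ((integrableOn_Iic_iff_integrableOn_Iio).2 jN) jP', integral_Iic_eq_integral_Iio,
      ← Set.Ioc_union_Ioi_eq_Ioi hT,
      setIntegral_union (Set.Ioc_disjoint_Ioi le_rfl) measurableSet_Ioi jP jT,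
      ← setIntegral_congr_fun measurableSet_Iio cN, ← setIntegral_congr_fun measurableSet_Ioc cP,
      ← setIntegral_congr_fun measurableSet_Ioi cT,
      integral_const_mul, integral_const_mul, integral_const_mul, eN, eP,
      integral_exp_mul_Ioi (by linarith)]
    congr 1
    · congr 1
      refine setIntegral_congr_fun measurableSet_Ioo fun z hz => ?_
      have : 0 < ϑ - z := by linarith [hz.2]
      simp only [← exp_add, ← add_mul]
      rw [← integral_Iic_eq_integral_Iio, integral_exp_mul_Iic (by linarith)]
      simp [sub_eq_add_neg]
    · congr 1
      · congr 1
        refine setIntegral_congr_fun measurableSet_Ioo fun z hz => ?_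
        have : η + z ≠ 0 := by linarith [hz.1]
        simp only [one_mul]
        rw [integral_Ioc_exp_neg_mul this hT]
      · rw [show -η * T = ρ * T + -(η + ρ) * T by ring, exp_add]
        field_simp
  have hD : D₃ * exp (-η * T) / (η + ρ)
      = ∫ z in Set.Ioo (-η) 0, w z * exp (-x * z) * exp (-((η + z) * T)) := by
    rw [hD₃, mul_div_assoc, ← integral_mul_const]
    refine integral_congr_ae (Eventually.of_forall fun z => ?_)
    simp only [hw_def]
    rw [mul_assoc (h z / (η + z)), ← exp_add,
      show -x * z + -((η + z) * T) = -c * z + -η * T by rw [hT_def]; ring, exp_add]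
    field_simp
  have hP : (∫ z in Set.Ioo (-η) 0, h z * exp (-x * z) *
            ((1 - exp (-((η + z) * T))) / (η + z))) + D₃ * exp (-η * T) / (η + ρ)
      = ∫ z in Set.Ioo (-η) 0, w z * exp (-x * z) := by
    have e : ∀ z ∈ Set.Ioo (-η) 0, h z * exp (-x * z) * ((1 - exp (-((η + z) * T))) / (η + z))
        = w z * exp (-x * z) - w z * exp (-x * z) * exp (-((η + z) * T)) := fun z hz => by
      simp only [hw_def]; ring
    rw [setIntegral_congr_fun measurableSet_Ioo e, hD, integral_sub hwx
      (integrableOn_mul_continuous_Ioo hwx (φ := fun z => exp (-((η + z) * T)))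
        (by fun_prop))]
    ring
  have hJ' : ∫ y, g₁ (x + y) * fY y
      = (1 - p) * ϑ * (∫ z in Set.Ioo (-η) 0, h z * exp (-x * z) * (1 / (ϑ - z)))
        + p * η * ∫ z in Set.Ioo (-η) 0, w z * exp (-x * z) := by
    rw [hJ, ← hP]; ring
  have i1 : IntegrableOn (fun z => -z * h z * exp (-x * z)) (Set.Ioo (-η) 0) :=
    integrableOn_mul_continuous_Ioo hzh (φ := fun z => exp (-x * z)) (by fun_prop)
  have i2 : IntegrableOn (fun z => -z * (-z * h z) * exp (-x * z)) (Set.Ioo (-η) 0) :=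
    (integrableOn_mul_continuous_Ioo i1 (φ := fun z => -z) (by fun_prop)).congr
      (Eventually.of_forall fun z => by simp only; ring)
  have i3 : IntegrableOn (fun z => h z * exp (-x * z) * (1 / (ϑ - z))) (Set.Ioo (-η) 0) :=
    integrableOn_mul_continuous_Ioo hhx (φ := fun z => 1 / (ϑ - z))
      (ContinuousOn.div (by fun_prop) (by fun_prop) hne)
  have key := setIntegral_deriv_rpow_mul_exp_mul_rpow_eq_zero ha hb hη hϑ d
    (-(σ ^ 2 / (4 * κ))) (μ / κ - x)
  rw [hF2, hF1, hJ', hF₃]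
  simp only
  have i12 : IntegrableOn (fun z => (μ - κ * x) * (-z * h z * exp (-x * z))
      + σ ^ 2 / 2 * (-z * (-z * h z) * exp (-x * z))) (Set.Ioo (-η) 0) :=
    (i1.const_mul _).add (i2.const_mul _)
  have i34 : IntegrableOn (fun z => lam * ((1 - p) * ϑ) * (h z * exp (-x * z) * (1 / (ϑ - z)))
      + lam * (p * η) * (w z * exp (-x * z))) (Set.Ioo (-η) 0) :=
    (i3.const_mul _).add (hwx.const_mul _)
  rw [mul_add, ← mul_assoc lam ((1 - p) * ϑ), ← mul_assoc lam (p * η), ← integral_const_mul,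
    ← integral_const_mul, ← integral_const_mul, ← integral_const_mul, ← integral_const_mul,
    ← integral_add (i3.const_mul _) (hwx.const_mul _),
    ← integral_add (i1.const_mul _) (i2.const_mul _), ← integral_add i12 i34,
    ← integral_sub (by exact i12.add i34) (hhx.const_mul _)]
  refine Eq.trans (setIntegral_congr_fun measurableSet_Ioo fun z hz => ?_)
    ((integral_const_mul κ _).trans ((congrArg (κ * ·) key).trans (mul_zero κ)))
  have h3 : ϑ - z ≠ 0 := by linarith [hz.2]
  rw [hh z hz, hwS z hz]
  have hE : exp (-(σ ^ 2 / (4 * κ)) * z ^ 2 + (μ / κ - x) * z)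
      = exp (-(σ ^ 2 / (4 * κ)) * z ^ 2 + μ / κ * z) * exp (-x * z) := by
    rw [← exp_add]; ring_nf
  simp only [hE]
  generalize exp (-(σ ^ 2 / (4 * κ)) * z ^ 2 + μ / κ * z) = E1
  generalize exp (-x * z) = E2
  generalize (-z) ^ (a - 1) = R1
  generalize (η + z) ^ (b - 1) = R2
  generalize (ϑ - z) ^ d = R3
  rw [ha_def, hb_def, hd_def]
  field_simp
  ring
end

section
/- Let c ∈ ℝ and ρ ≥ 0, and define g₂ : ℝ → ℝ by g₂(x) = F₄^q(x) for x ≤ c and g₂(x) = D₄·e^{−ρ(x−c)} for x > c, where D₄ = ∫_{Γ₄} ((η+ρ)/(z+η))·h_q(z)·e^{−cz} dz. Then for every x ≤ c, (μ − κx)·(F₄^q)′(x) + (σ²/2)·(F₄^q)″(x) + λ·∫_ℝ g₂(x+y)·f_Y(y) dy − (λ+q)·F₄^q(x) = 0, all integrals converging absolutely. -/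
open Real MeasureTheory Filter Topology

lemma rpow_le_rpow_mul_exp {e x : ℝ} (he : 0 < e) (hx : e ≤ x) (r : ℝ) :
    x ^ r ≤ e ^ r * exp (|r| * (x / e)) := by
  have hx0 : 0 < x := he.trans_le hx
  have hxe : x = e * (x / e) := by field_simp
  have h1 : 1 ≤ x / e := (one_le_div he).2 hx
  conv_lhs => rw [hxe]
  rw [mul_rpow he.le (by positivity), rpow_def_of_pos (by positivity : 0 < x / e)]
  refine mul_le_mul_of_nonneg_left (exp_le_exp.2 ?_) (rpow_nonneg he.le r)
  have h2 : log (x / e) ≤ x / e := (log_le_sub_one_of_pos (by positivity)).trans (by linarith)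
  calc log (x / e) * r ≤ log (x / e) * |r| := by
        gcongr
        · exact log_nonneg h1
        · exact le_abs_self r
    _ ≤ x / e * |r| := by gcongr
    _ = |r| * (x / e) := mul_comm _ _

lemma integrableOn_gaussian_mul_rpow {A η ϑ α : ℝ} (hA : 0 < A) (hη : 0 < η) (hϑ : 0 < ϑ)
    (hα : -1 < α) (r m b : ℝ) :
    IntegrableOn (fun z : ℝ => |z| ^ r * exp (-A * z ^ 2 + m * z) * |η + z| ^ α * |z - ϑ| ^ b)
      (Set.Iio (-η)) := by
  set M : ℝ := -m + |r| / η + |b| / ϑ with hM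
  set C : ℝ := η ^ r * ϑ ^ b * exp (η * M + |b| + M ^ 2 / (2 * A)) with hC
  have hg : Integrable fun z : ℝ => C * ((-η - z) ^ α * exp (-(A / 2) * (-η - z) ^ 2)) :=
    ((integrable_rpow_mul_exp_neg_mul_sq (half_pos hA) hα).comp_sub_left (-η)).const_mul C
  refine hg.integrableOn.mono' (by fun_prop) ?_
  refine (ae_restrict_mem measurableSet_Iio).mono fun z (hz : z < -η) => ?_
  rw [norm_of_nonneg (by positivity), abs_of_neg (by linarith : z < 0),
    abs_of_neg (by linarith : η + z < 0), abs_of_neg (by linarith : z - ϑ < 0)]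
  have h1 := rpow_le_rpow_mul_exp hη (by linarith : η ≤ -z) r
  have h2 := rpow_le_rpow_mul_exp hϑ (by linarith : ϑ ≤ -(z - ϑ)) b
  have h3 : |r| * (-z / η) + (-A * z ^ 2 + m * z) + |b| * (-(z - ϑ) / ϑ)
      ≤ η * M + |b| + M ^ 2 / (2 * A) + -(A / 2) * (-η - z) ^ 2 := by
    have e1 : |r| * (-z / η) + (-A * z ^ 2 + m * z) + |b| * (-(z - ϑ) / ϑ)
        = -A * z ^ 2 - z * M + |b| := by
      rw [hM]; field_simp; ring
    have e2 : M ^ 2 / (2 * A) - M * (-η - z) + A / 2 * (-η - z) ^ 2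
        = (M - A * (-η - z)) ^ 2 / (2 * A) := by field_simp; ring
    have e3 : 0 ≤ (M - A * (-η - z)) ^ 2 / (2 * A) := by positivity
    have e4 : 0 ≤ A * (z ^ 2 - (-η - z) ^ 2) := mul_nonneg hA.le (by nlinarith)
    rw [e1]; nlinarith
  have hpos : 0 ≤ (-(η + z)) ^ α := rpow_nonneg (by linarith) _
  calc (-z) ^ r * exp (-A * z ^ 2 + m * z) * (-(η + z)) ^ α * (-(z - ϑ)) ^ b
      ≤ (η ^ r * exp (|r| * (-z / η))) * exp (-A * z ^ 2 + m * z) * (-(η + z)) ^ α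
          * (ϑ ^ b * exp (|b| * (-(z - ϑ) / ϑ))) := by
        have : 0 ≤ (-(z - ϑ)) ^ b := rpow_nonneg (by linarith) _
        gcongr
    _ = η ^ r * ϑ ^ b * (-(η + z)) ^ α
          * exp (|r| * (-z / η) + (-A * z ^ 2 + m * z) + |b| * (-(z - ϑ) / ϑ)) := by
        rw [exp_add _ (|b| * _), exp_add (|r| * _)]; ac_rfl
    _ ≤ η ^ r * ϑ ^ b * (-(η + z)) ^ α
          * exp (η * M + |b| + M ^ 2 / (2 * A) + -(A / 2) * (-η - z) ^ 2) := by gcongr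
    _ = C * ((-η - z) ^ α * exp (-(A / 2) * (-η - z) ^ 2)) := by
        rw [hC, exp_add _ (-(A / 2) * _), show -(η + z) = -η - z by ring]; ring

lemma integrableOn_and_hasDerivAt_laplace {k : ℝ → ℝ} (hk : Measurable k) (hk0 : ∀ z, 0 ≤ k z)
    {s : Set ℝ} (hint : ∀ x : ℝ, IntegrableOn (fun z => k z * exp (-x * z)) s) (n : ℕ) (x : ℝ) :
    IntegrableOn (fun z => k z * ((-z) ^ n * exp (-x * z))) s ∧
      HasDerivAt (fun x => ∫ z in s, k z * ((-z) ^ n * exp (-x * z)))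
        (∫ z in s, k z * ((-z) ^ (n + 1) * exp (-x * z))) x := by
  let w : ℝ → NNReal := fun z => (k z).toNNReal
  have hw : Measurable w := hk.real_toNNReal
  have hwk : ∀ z, ((w z : NNReal) : ℝ) = k z := fun z => Real.coe_toNNReal _ (hk0 z)
  set ν := (volume.restrict s).withDensity fun z => (w z : ENNReal) with hν
  have hset : ProbabilityTheory.integrableExpSet (fun z : ℝ => -z) ν = Set.univ := by
    refine Set.eq_univ_of_forall fun t => ?_
    change Integrable _ _
    rw [hν, integrable_withDensity_iff_integrable_smul hw]
    simpa [NNReal.smul_def, hwk] using! hint t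
  have hx : x ∈ interior (ProbabilityTheory.integrableExpSet (fun z : ℝ => -z) ν) := by
    simp [hset]
  constructor
  · have := ProbabilityTheory.integrable_pow_mul_exp_of_mem_interior_integrableExpSet hx n
    rw [hν, integrable_withDensity_iff_integrable_smul hw] at this
    simpa [NNReal.smul_def, hwk] using! this
  · have := ProbabilityTheory.hasDerivAt_integral_pow_mul_exp_real hx n
    simp only [hν, integral_withDensity_eq_integral_smul hw] at this
    simpa [NNReal.smul_def, hwk] using this

lemma integrable_and_integral_integral_swap_of_nonneg {ν τ : Measure ℝ} [SFinite ν] [SFinite τ]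
    {f : ℝ → ℝ → ℝ} (hf : Measurable (Function.uncurry f)) (hf0 : ∀ z y, 0 ≤ f z y)
    (hf1 : ∀ᵐ z ∂ν, Integrable (f z) τ) (hf2 : Integrable (fun z => ∫ y, f z y ∂τ) ν) :
    Integrable (fun y => ∫ z, f z y ∂ν) τ ∧
      ∫ y, ∫ z, f z y ∂ν ∂τ = ∫ z, ∫ y, f z y ∂τ ∂ν := by
  have h : Integrable (Function.uncurry f) (ν.prod τ) := by
    rw [integrable_prod_iff hf.aestronglyMeasurable]
    refine ⟨hf1, ?_⟩
    simpa [Function.uncurry, abs_of_nonneg (hf0 _ _)] using hf2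
  exact ⟨h.integral_prod_right, (integral_integral_swap h).symm⟩


/-- The Gaussian weight with algebraic factors at `0`, `-η` and `ϑ`. -/
noncomputable def gaussianRpowWeight (A η ϑ r m a b z : ℝ) : ℝ :=
  |z| ^ r * exp (-A * z ^ 2 + m * z) * |η + z| ^ a * |z - ϑ| ^ b

section Weight

variable {A η ϑ r m a b : ℝ}

local notation "W" => gaussianRpowWeight

lemma measurable_gaussianRpowWeight : Measurable (W A η ϑ r m a b) := by
  unfold gaussianRpowWeight; fun_prop

lemma gaussianRpowWeight_nonneg (z : ℝ) : 0 ≤ W A η ϑ r m a b z := by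
  unfold gaussianRpowWeight; positivity

lemma gaussianRpowWeight_mul_exp (x z : ℝ) :
    W A η ϑ r m a b z * exp (-x * z) = W A η ϑ r (m - x) a b z := by
  simp only [gaussianRpowWeight]
  rw [show -A * z ^ 2 + (m - x) * z = (-A * z ^ 2 + m * z) + -x * z by ring, exp_add _ (-x * z)]
  ring

lemma gaussianRpowWeight_div_add {z : ℝ} (hz : z < -η) :
    W A η ϑ r m a b z / (η + z) = -W A η ϑ r m (a - 1) b z := by
  have h0 : η + z < 0 := by linarith
  simp only [gaussianRpowWeight]
  rw [abs_of_neg h0, rpow_sub_one (by linarith)]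
  have := h0.ne
  field_simp

lemma gaussianRpowWeight_div_sub {z : ℝ} (hz : z < ϑ) :
    W A η ϑ r m a b z / (ϑ - z) = W A η ϑ r m a (b - 1) z := by
  have h0 : z - ϑ < 0 := by linarith
  simp only [gaussianRpowWeight]
  rw [abs_of_neg h0, rpow_sub_one (by linarith), neg_sub]
  have : ϑ - z ≠ 0 := by linarith
  field_simp

lemma integrableOn_gaussianRpowWeight_div_add (hA : 0 < A) (hη : 0 < η) (hϑ : 0 < ϑ) (ha : 0 < a) :
    IntegrableOn (fun z => W A η ϑ r m a b z / (η + z)) (Set.Iio (-η)) :=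
  (integrableOn_gaussian_mul_rpow hA hη hϑ (by linarith : -1 < a - 1) r m b).neg.congr_fun
    (fun _ hz => (gaussianRpowWeight_div_add hz).symm) measurableSet_Iio

lemma integrableOn_gaussianRpowWeight_div_sub (hA : 0 < A) (hη : 0 < η) (hϑ : 0 < ϑ) (ha : 0 < a) :
    IntegrableOn (fun z => W A η ϑ r m a b z / (ϑ - z)) (Set.Iio (-η)) :=
  (integrableOn_gaussian_mul_rpow hA hη hϑ (by linarith : -1 < a) r m (b - 1)).congr_fun
    (fun z hz => (gaussianRpowWeight_div_sub (by linarith [Set.mem_Iio.1 hz])).symm)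
    measurableSet_Iio

lemma hasDerivAt_gaussianRpowWeight (hη : 0 < η) (hϑ : 0 < ϑ) {z : ℝ} (hz : z < -η) :
    HasDerivAt (W A η ϑ r m a b)
      (W A η ϑ r m a b z * (r / z - 2 * A * z + m + a / (η + z) - b / (ϑ - z))) z := by
  have h1 : 0 < -z := by linarith
  have h2 : 0 < -(η + z) := by linarith
  have h3 : 0 < -(z - ϑ) := by linarith
  have hE : W A η ϑ r m a b =ᶠ[𝓝 z] fun z =>
      (-z) ^ r * exp (-A * z ^ 2 + m * z) * (-(η + z)) ^ a * (-(z - ϑ)) ^ b := by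
    filter_upwards [Iio_mem_nhds hz] with w hw
    have hw : w < -η := hw
    rw [gaussianRpowWeight, abs_of_neg (by linarith : w < 0), abs_of_neg (by linarith : η + w < 0),
      abs_of_neg (by linarith : w - ϑ < 0)]
  have d1 : HasDerivAt (fun z : ℝ => (-z) ^ r) _ z :=
    (hasDerivAt_id z).neg.rpow_const (p := r) (Or.inl h1.ne')
  have d2 : HasDerivAt (fun z : ℝ => (-(η + z)) ^ a) _ z :=
    ((hasDerivAt_id z).const_add η).neg.rpow_const (p := a) (Or.inl h2.ne')
  have d3 : HasDerivAt (fun z : ℝ => (-(z - ϑ)) ^ b) _ z :=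
    ((hasDerivAt_id z).sub_const ϑ).neg.rpow_const (p := b) (Or.inl h3.ne')
  have d4 : HasDerivAt (fun z : ℝ => exp (-A * z ^ 2 + m * z)) _ z :=
    (((hasDerivAt_pow 2 z).const_mul (-A)).add ((hasDerivAt_id z).const_mul m)).exp
  refine ((((d1.mul d4).mul d2).mul d3).congr_of_eventuallyEq hE).congr_deriv ?_
  rw [hE.eq_of_nhds]
  simp only [id, Pi.neg_apply, Pi.mul_apply]
  rw [rpow_sub_one h1.ne', rpow_sub_one h2.ne', rpow_sub_one h3.ne']
  have e1 : z ≠ 0 := by linarith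
  have e2 : η + z ≠ 0 := by linarith
  have e3 : ϑ - z ≠ 0 := by linarith
  have e4 : z - ϑ ≠ 0 := by linarith
  rw [show ϑ - z = -(z - ϑ) by ring]
  field_simp
  norm_num
  ring_nf

lemma integrableOn_gaussianRpowWeight_mul_exp (hA : 0 < A) (hη : 0 < η) (hϑ : 0 < ϑ) (ha : 0 < a)
    (x : ℝ) :
    IntegrableOn (fun z => W A η ϑ r m a b z * exp (-x * z)) (Set.Iio (-η)) := by
  simp_rw [gaussianRpowWeight_mul_exp]
  exact integrableOn_gaussian_mul_rpow hA hη hϑ (by linarith) r (m - x) b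

lemma integral_gaussianRpowWeight_by_parts (hA : 0 < A) (hη : 0 < η) (hϑ : 0 < ϑ) (ha : 0 < a) :
    (1 + r + a + b) * (∫ z in Set.Iio (-η), W A η ϑ r m a b z)
      + m * (∫ z in Set.Iio (-η), W A η ϑ r m a b z * z)
      - 2 * A * (∫ z in Set.Iio (-η), W A η ϑ r m a b z * z ^ 2)
      - a * η * (∫ z in Set.Iio (-η), W A η ϑ r m a b z / (η + z))
      - b * ϑ * (∫ z in Set.Iio (-η), W A η ϑ r m a b z / (ϑ - z)) = 0 := by
  have hL := fun n => (integrableOn_and_hasDerivAt_laplace (k := W A η ϑ r m a b)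
    measurable_gaussianRpowWeight gaussianRpowWeight_nonneg
    (integrableOn_gaussianRpowWeight_mul_exp hA hη hϑ ha) n 0).1
  have i0 : IntegrableOn (fun z => W A η ϑ r m a b z) (Set.Iio (-η)) := by simpa using hL 0
  have i1 : IntegrableOn (fun z => W A η ϑ r m a b z * z) (Set.Iio (-η)) := by
    simpa using (hL 1).neg
  have i2 : IntegrableOn (fun z => W A η ϑ r m a b z * z ^ 2) (Set.Iio (-η)) := by
    simpa using hL 2
  have i3 := integrableOn_gaussianRpowWeight_div_add (r := r) (m := m) (b := b) hA hη hϑ ha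
  have i4 := integrableOn_gaussianRpowWeight_div_sub (r := r) (m := m) (b := b) hA hη hϑ ha
  rw [← integral_const_mul, ← integral_const_mul, ← integral_const_mul, ← integral_const_mul,
    ← integral_const_mul]
  have j0 := i0.const_mul (1 + r + a + b)
  have j1 := i1.const_mul m
  have j2 := i2.const_mul (2 * A)
  have j3 := i3.const_mul (a * η)
  have j4 := i4.const_mul (b * ϑ)
  have j01 : IntegrableOn (fun z => (1 + r + a + b) * W A η ϑ r m a b z
      + m * (W A η ϑ r m a b z * z)) (Set.Iio (-η)) := j0.add j1
  have j012 : IntegrableOn (fun z => (1 + r + a + b) * W A η ϑ r m a b z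
      + m * (W A η ϑ r m a b z * z) - 2 * A * (W A η ϑ r m a b z * z ^ 2)) (Set.Iio (-η)) :=
    j01.sub j2
  have j0123 : IntegrableOn (fun z => (1 + r + a + b) * W A η ϑ r m a b z
      + m * (W A η ϑ r m a b z * z) - 2 * A * (W A η ϑ r m a b z * z ^ 2)
      - a * η * (W A η ϑ r m a b z / (η + z))) (Set.Iio (-η)) := j012.sub j3
  rw [← integral_add j0 j1, ← integral_sub j01 j2, ← integral_sub j012 j3,
    ← integral_sub j0123 j4]
  have jj := j0123.sub j4
  have hd : ∀ z ∈ Set.Iio (-η), HasDerivAt (fun z => W A η ϑ r m a b z * z)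
      ((1 + r + a + b) * W A η ϑ r m a b z + m * (W A η ϑ r m a b z * z)
        - 2 * A * (W A η ϑ r m a b z * z ^ 2) - a * η * (W A η ϑ r m a b z / (η + z))
        - b * ϑ * (W A η ϑ r m a b z / (ϑ - z))) z := by
    intro z hz
    have hz : z < -η := hz
    refine ((hasDerivAt_gaussianRpowWeight hη hϑ hz).mul (hasDerivAt_id z)).congr_deriv ?_
    have e1 : z ≠ 0 := by linarith
    have e2 : η + z ≠ 0 := by linarith
    have e3 : ϑ - z ≠ 0 := by linarith
    simp only [id]
    field_simp
    ring
  have hsub : Set.Iic (-η - 1) ⊆ Set.Iio (-η) := Set.Iic_subset_Iio.2 (by linarith)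
  have ht := tendsto_zero_of_hasDerivAt_of_integrableOn_Iic (fun z hz => hd z (hsub hz))
    (jj.mono_set hsub) (i1.mono_set hsub)
  have hc : ContinuousAt (fun z => W A η ϑ r m a b z * z) (-η) := by
    unfold gaussianRpowWeight
    refine ContinuousAt.mul (ContinuousAt.mul (ContinuousAt.mul (ContinuousAt.mul ?_ ?_) ?_) ?_)
      continuousAt_id
    · exact ContinuousAt.rpow_const (by fun_prop) (Or.inl (by simpa using hη.ne'))
    · fun_prop
    · exact ContinuousAt.rpow_const (by fun_prop) (Or.inr ha.le)
    · exact ContinuousAt.rpow_const (by fun_prop) (Or.inl (abs_ne_zero.2 (by linarith)))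
  have key := integral_Iic_of_hasDerivAt_of_tendsto hc.continuousWithinAt hd
    ((integrableOn_Iic_iff_integrableOn_Iio (by simp)).2 jj) ht
  rw [integral_Iic_eq_integral_Iio] at key
  refine Eq.trans ?_ (key.trans ?_)
  · rfl
  · simp [gaussianRpowWeight, zero_rpow ha.ne']

end Weight

lemma integral_laplace_mul_exp_Iic {h : ℝ → ℝ} (hm : Measurable h) (h0 : ∀ z, 0 ≤ h z) {η ϑ x : ℝ}
    (hη : 0 < η) (hϑ : 0 < ϑ)
    (hint : IntegrableOn (fun z => h z * exp (-x * z) / (ϑ - z)) (Set.Iio (-η))) :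
    IntegrableOn (fun y => (∫ z in Set.Iio (-η), h z * exp (-(x + y) * z)) * exp (ϑ * y))
        (Set.Iic 0) ∧
      ∫ y in Set.Iic 0, (∫ z in Set.Iio (-η), h z * exp (-(x + y) * z)) * exp (ϑ * y)
        = ∫ z in Set.Iio (-η), h z * exp (-x * z) / (ϑ - z) := by
  have hE : ∀ z y : ℝ, h z * exp (-(x + y) * z) * exp (ϑ * y)
      = h z * exp (-x * z) * exp ((ϑ - z) * y) := fun z y => by
    rw [mul_assoc, mul_assoc, ← exp_add, ← exp_add]; ring_nf
  have hI : Set.EqOn (fun z => ∫ y in Set.Iic (0 : ℝ), h z * exp (-x * z) * exp ((ϑ - z) * y))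
      (fun z => h z * exp (-x * z) / (ϑ - z)) (Set.Iio (-η)) := fun z hz => by
    have hz : z < -η := hz
    simp only
    rw [integral_const_mul, integral_exp_mul_Iic (by linarith)]
    simp [div_eq_mul_inv]
  simp_rw [← integral_mul_const, hE]
  rw [← setIntegral_congr_fun measurableSet_Iio hI]
  refine integrable_and_integral_integral_swap_of_nonneg
    (f := fun z y => h z * exp (-x * z) * exp ((ϑ - z) * y)) (by fun_prop)
    (fun z y => mul_nonneg (mul_nonneg (h0 z) (exp_pos _).le) (exp_pos _).le)
    ((ae_restrict_mem measurableSet_Iio).mono fun z (hz : z < -η) => ?_)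
    (hint.congr_fun hI.symm measurableSet_Iio)
  exact (integrableOn_exp_mul_Iic (by linarith) 0).const_mul _

lemma integral_laplace_mul_exp_Ioc {h : ℝ → ℝ} (hm : Measurable h) (h0 : ∀ z, 0 ≤ h z) {η x d : ℝ}
    (hd : 0 ≤ d)
    (hint : ∀ x, IntegrableOn (fun z => h z * exp (-x * z) / (η + z)) (Set.Iio (-η))) :
    IntegrableOn (fun y => (∫ z in Set.Iio (-η), h z * exp (-(x + y) * z)) * exp (-η * y))
        (Set.Ioc 0 d) ∧
      ∫ y in Set.Ioc 0 d, (∫ z in Set.Iio (-η), h z * exp (-(x + y) * z)) * exp (-η * y)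
        = (∫ z in Set.Iio (-η), h z * exp (-x * z) / (η + z))
          - exp (-η * d) * ∫ z in Set.Iio (-η), h z * exp (-(x + d) * z) / (η + z) := by
  have hE : ∀ z y : ℝ, h z * exp (-(x + y) * z) * exp (-η * y)
      = h z * exp (-x * z) * exp (-(η + z) * y) := fun z y => by
    rw [mul_assoc, mul_assoc, ← exp_add, ← exp_add]; ring_nf
  have hi := (hint (x + d)).const_mul (exp (-η * d))
  have hI : Set.EqOn
      (fun z => ∫ y in Set.Ioc (0 : ℝ) d, h z * exp (-x * z) * exp (-(η + z) * y))
      (fun z => h z * exp (-x * z) / (η + z)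
        - exp (-η * d) * (h z * exp (-(x + d) * z) / (η + z))) (Set.Iio (-η)) := fun z hz => by
    have hz : z < -η := hz
    have hz0 : η + z ≠ 0 := by linarith
    have h1 := hE z d
    simp only
    rw [integral_const_mul, ← intervalIntegral.integral_of_le hd,
      intervalIntegral.integral_comp_mul_left (fun y => exp y) (neg_ne_zero.2 hz0), integral_exp,
      mul_zero, exp_zero, smul_eq_mul]
    rw [show exp (-η * d) * (h z * exp (-(x + d) * z) / (η + z))
      = h z * exp (-x * z) * exp (-(η + z) * d) / (η + z) by rw [← h1]; ring]
    generalize exp (-(η + z) * d) = u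
    field_simp
    ring
  simp_rw [← integral_mul_const, hE]
  rw [← integral_const_mul, ← integral_sub (hint x) hi,
    ← setIntegral_congr_fun measurableSet_Iio hI]
  refine integrable_and_integral_integral_swap_of_nonneg
    (f := fun z y => h z * exp (-x * z) * exp (-(η + z) * y)) (by fun_prop)
    (fun z y => mul_nonneg (mul_nonneg (h0 z) (exp_pos _).le) (exp_pos _).le)
    (ae_of_all _ fun z => ?_)
    (((hint x).sub hi).congr_fun hI.symm measurableSet_Iio)
  exact (Continuous.integrableOn_Icc (by fun_prop)).mono_set Set.Ioc_subset_Icc_self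

/-- With `g₂(x) = F₄^q(x)` for `x ≤ c` and `g₂(x) = D₄ e^{−ρ(x−c)}` for
`x > c`, where `D₄ = ∫_{Γ₄} ((η+ρ)/(z+η)) h_q(z) e^{−cz} dz` and `Γ₄ = (−∞,−η)`,
for every `x ≤ c`,
`(μ − κx)(F₄^q)'(x) + (σ²/2)(F₄^q)''(x) + λ ∫_ℝ g₂(x+y) f_Y(y) dy − (λ+q) F₄^q(x) = 0`,
all integrals converging absolutely. -/
theorem stmt9 (κ μ σ lam p η ϑ q c ρ : ℝ)
    (hκ : 0 < κ) (hσ : 0 < σ) (hlam : 0 < lam) (hp : 0 < p) (hp1 : p < 1)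
    (hη : 0 < η) (hϑ : 0 < ϑ) (hq : 0 < q) (hρ : 0 ≤ ρ)
    (h : ℝ → ℝ)
    (hdef : ∀ z : ℝ, h z =
      |z| ^ (q / κ - 1) * Real.exp (-σ ^ 2 * z ^ 2 / (4 * κ) + μ * z / κ)
        * |η + z| ^ (lam * p / κ) * |z - ϑ| ^ (lam * (1 - p) / κ))
    (fY : ℝ → ℝ)
    (hfY : ∀ y : ℝ, fY y =
      if 0 < y then p * η * Real.exp (-η * y)
      else if y < 0 then (1 - p) * ϑ * Real.exp (ϑ * y) else 0)
    (F₄ : ℝ → ℝ)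
    (hF₄ : ∀ x : ℝ, F₄ x = ∫ z in Set.Iio (-η), h z * Real.exp (-x * z))
    (D₄ : ℝ)
    (hD₄ : D₄ = ∫ z in Set.Iio (-η), (η + ρ) / (z + η) * h z * Real.exp (-c * z))
    (g₂ : ℝ → ℝ)
    (hg₂ : ∀ x : ℝ, x ≤ c → g₂ x = F₄ x)
    (hg₂' : ∀ x : ℝ, c < x → g₂ x = D₄ * Real.exp (-ρ * (x - c))) :
    (∀ x : ℝ, MeasureTheory.IntegrableOn
        (fun z : ℝ => h z * Real.exp (-x * z)) (Set.Iio (-η))) ∧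
    ∀ x : ℝ, x ≤ c →
      MeasureTheory.Integrable (fun y : ℝ => g₂ (x + y) * fY y) ∧
      (μ - κ * x) * deriv F₄ x + σ ^ 2 / 2 * deriv (deriv F₄) x
        + lam * (∫ y : ℝ, g₂ (x + y) * fY y) - (lam + q) * F₄ x = 0 := by
  set A := σ ^ 2 / (4 * κ) with hA'
  set r := q / κ - 1 with hr'
  set a := lam * p / κ with ha'
  set b := lam * (1 - p) / κ with hb'
  have hA : 0 < A := by positivity
  have ha : 0 < a := by positivity
  have hW : h = gaussianRpowWeight A η ϑ r (μ / κ) a b := by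
    funext z
    rw [hdef, gaussianRpowWeight]
    congr 4
    rw [hA']; ring
  have hm : Measurable h := hW ▸ measurable_gaussianRpowWeight
  have h0 : ∀ z, 0 ≤ h z := fun z => hW ▸ gaussianRpowWeight_nonneg z
  have hWx : ∀ x z, h z * exp (-x * z) = gaussianRpowWeight A η ϑ r (μ / κ - x) a b z :=
    fun x z => by rw [hW, gaussianRpowWeight_mul_exp]
  have hint : ∀ x : ℝ, IntegrableOn (fun z : ℝ => h z * exp (-x * z)) (Set.Iio (-η)) := by
    rw [hW]; exact integrableOn_gaussianRpowWeight_mul_exp hA hη hϑ ha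
  have hintη : ∀ x : ℝ, IntegrableOn (fun z => h z * exp (-x * z) / (η + z)) (Set.Iio (-η)) := by
    intro x
    simp_rw [hWx]
    exact integrableOn_gaussianRpowWeight_div_add hA hη hϑ ha
  have hintϑ : ∀ x : ℝ, IntegrableOn (fun z => h z * exp (-x * z) / (ϑ - z)) (Set.Iio (-η)) := by
    intro x
    simp_rw [hWx]
    exact integrableOn_gaussianRpowWeight_div_sub hA hη hϑ ha
  have hL := fun n x => (integrableOn_and_hasDerivAt_laplace hm h0 hint n x).2
  have hF1 : deriv F₄ = fun x => ∫ z in Set.Iio (-η), h z * ((-z) ^ 1 * exp (-x * z)) := by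
    have : F₄ = fun x => ∫ z in Set.Iio (-η), h z * ((-z) ^ 0 * exp (-x * z)) := by
      funext x; simp [hF₄]
    rw [this]
    exact funext fun x => (hL 0 x).deriv
  have hF2 : ∀ x, deriv (deriv F₄) x = ∫ z in Set.Iio (-η), h z * exp (-x * z) * z ^ 2 := by
    intro x
    rw [hF1, (hL 1 x).deriv]
    congr 1 with z
    ring
  have hF1' : ∀ x, deriv F₄ x = -∫ z in Set.Iio (-η), h z * exp (-x * z) * z := by
    intro x
    simp only [hF1]
    rw [← integral_neg]
    congr 1 with z
    ring
  refine ⟨hint, fun x hx => ?_⟩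
  have hd : 0 ≤ c - x := by linarith
  have hηρ : 0 < η + ρ := by linarith
  obtain ⟨n1, n1'⟩ := integral_laplace_mul_exp_Iic hm h0 hη hϑ (hintϑ x)
  obtain ⟨n2, n2'⟩ := integral_laplace_mul_exp_Ioc (x := x) hm h0 hd hintη
  have n3 := integrableOn_exp_mul_Ioi (neg_lt_zero.2 hηρ) (c - x)
  have n3' := integral_exp_mul_Ioi (neg_lt_zero.2 hηρ) (c - x)
  simp_rw [← hF₄] at n1 n1' n2 n2'
  have s1 : Set.EqOn (fun y => (1 - p) * ϑ * (F₄ (x + y) * exp (ϑ * y)))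
      (fun y => g₂ (x + y) * fY y) (Set.Iio 0) := fun y hy => by
    have hy : y < 0 := hy
    simp only
    rw [hg₂ _ (by linarith), hfY, if_neg hy.not_gt, if_pos hy]
    ring
  have s2 : Set.EqOn (fun y => p * η * (F₄ (x + y) * exp (-η * y)))
      (fun y => g₂ (x + y) * fY y) (Set.Ioc 0 (c - x)) := fun y hy => by
    simp only
    rw [hg₂ _ (by linarith [hy.2]), hfY, if_pos hy.1]
    ring
  have s3 : Set.EqOn (fun y => p * η * D₄ * exp (ρ * (c - x)) * exp (-(η + ρ) * y))
      (fun y => g₂ (x + y) * fY y) (Set.Ioi (c - x)) := fun y hy => by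
    have hy : c - x < y := hy
    simp only
    rw [hg₂' _ (by linarith), hfY, if_pos (by linarith), mul_assoc _ (exp _), ← exp_add,
      show ρ * (c - x) + -(η + ρ) * y = -ρ * (x + y - c) + -η * y by ring, exp_add]
    ring
  have t1 : IntegrableOn (fun y => g₂ (x + y) * fY y) (Set.Iic 0) :=
    (integrableOn_Iic_iff_integrableOn_Iio enorm_ne_top).2
      (IntegrableOn.congr_fun ((n1.mono_set Set.Iio_subset_Iic_self).const_mul ((1 - p) * ϑ)) s1
        measurableSet_Iio)
  have t2 : IntegrableOn (fun y => g₂ (x + y) * fY y) (Set.Ioc 0 (c - x)) :=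
    IntegrableOn.congr_fun (n2.const_mul (p * η)) s2 measurableSet_Ioc
  have t3 : IntegrableOn (fun y => g₂ (x + y) * fY y) (Set.Ioi (c - x)) :=
    IntegrableOn.congr_fun (n3.const_mul _) s3 measurableSet_Ioi
  have t23 : IntegrableOn (fun y => g₂ (x + y) * fY y) (Set.Ioi 0) := by
    rw [← Set.Ioc_union_Ioi_eq_Ioi hd]; exact t2.union t3
  refine ⟨?_, ?_⟩
  · rw [← integrableOn_univ, ← Set.Iic_union_Ioi (a := (0 : ℝ))]
    exact t1.union t23
  have u1 : ∫ y in Set.Iic 0, g₂ (x + y) * fY y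
      = (1 - p) * ϑ * ∫ z in Set.Iio (-η), h z * exp (-x * z) / (ϑ - z) := by
    rw [integral_Iic_eq_integral_Iio, ← setIntegral_congr_fun measurableSet_Iio s1,
      integral_const_mul, ← integral_Iic_eq_integral_Iio, n1']
  have u2 := setIntegral_congr_fun (μ := volume) measurableSet_Ioc s2
  have u3 := setIntegral_congr_fun (μ := volume) measurableSet_Ioi s3
  rw [integral_const_mul, n2', show x + (c - x) = c by ring] at u2
  rw [integral_const_mul, n3'] at u3
  have hD : D₄ = (η + ρ) * ∫ z in Set.Iio (-η), h z * exp (-c * z) / (η + z) := by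
    rw [hD₄, ← integral_const_mul]
    congr 1 with z
    rw [add_comm z η]; ring
  have hjump : ∫ y, g₂ (x + y) * fY y
      = (1 - p) * ϑ * (∫ z in Set.Iio (-η), h z * exp (-x * z) / (ϑ - z))
        + p * η * ∫ z in Set.Iio (-η), h z * exp (-x * z) / (η + z) := by
    rw [← intervalIntegral.integral_Iic_add_Ioi t1 t23, ← Set.Ioc_union_Ioi_eq_Ioi hd,
      setIntegral_union (Set.Ioc_disjoint_Ioi le_rfl) measurableSet_Ioi t2 t3, u1, ← u2, ← u3, hD,
      show -(η + ρ) * (c - x) = -(ρ * (c - x)) + -η * (c - x) by ring, exp_add, exp_neg (ρ * _)]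
    have := (exp_pos (ρ * (c - x))).ne'
    field_simp
    ring
  have key := integral_gaussianRpowWeight_by_parts (r := r) (m := μ / κ - x) (b := b) hA hη hϑ ha
  simp_rw [← hWx] at key
  rw [hjump, hF1', hF2, hF₄]
  have c1 : κ * (1 + r + a + b) = lam + q := by rw [hr', ha', hb']; field_simp; ring
  have c2 : κ * (μ / κ - x) = μ - κ * x := by field_simp
  have c3 : κ * (2 * A) = σ ^ 2 / 2 := by rw [hA']; field_simp; ring
  have c4 : κ * a = lam * p := by rw [ha']; field_simp
  have c5 : κ * b = lam * (1 - p) := by rw [hb']; field_simp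
  generalize (∫ z in Set.Iio (-η), h z * exp (-x * z)) = I0 at key ⊢
  generalize (∫ z in Set.Iio (-η), h z * exp (-x * z) * z) = I1 at key ⊢
  generalize (∫ z in Set.Iio (-η), h z * exp (-x * z) * z ^ 2) = I2 at key ⊢
  generalize (∫ z in Set.Iio (-η), h z * exp (-x * z) / (η + z)) = I3 at key ⊢
  generalize (∫ z in Set.Iio (-η), h z * exp (-x * z) / (ϑ - z)) = I4 at key ⊢
  linear_combination (-κ) * key + I0 * c1 + I1 * c2 - I2 * c3 - η * I3 * c4 - ϑ * I4 * c5
end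

section
/- For i ∈ {3,4} and every x ∈ ℝ, the exponential smoothing of F_i^q from below equals the kernel-weighted transform: ∫_{−∞}^0 F_i^q(x+u)·ϑ·e^{ϑu} du = ∫_{Γ_i} ( ϑ/(ϑ−z) )·h_q(z)·e^{−xz} dz, i.e., it equals C_i^{0,q}(x), where C_i^{ξ,q}(x) = −∫_{Γ_i} ((ϑ+ξ)/(z−ϑ))·h_q(z)·e^{−xz} dz. -/
open Real MeasureTheory Filter Topology

theorem abs_add_rpow_le_exp (c z : ℝ) {α : ℝ} (hc : 0 ≤ c) (hα : 0 ≤ α) :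
    |c + z| ^ α ≤ exp (α * (c + |z|)) := by
  have hle : |c + z| ≤ exp (c + |z|) := by
    have h1 := abs_add_le c z
    rw [abs_of_nonneg hc] at h1
    linarith [add_one_le_exp (c + |z|)]
  calc |c + z| ^ α ≤ exp (c + |z|) ^ α := rpow_le_rpow (abs_nonneg _) hle hα
    _ = exp (α * (c + |z|)) := by rw [← exp_mul, mul_comm]

theorem integrableOn_Iio_abs_rpow_mul_exp_quadratic {a b : ℝ} (ha : -1 < a) (hb : 0 < b)
    (k m : ℝ) :
    IntegrableOn (fun z : ℝ => |z| ^ a * exp (-(2 * b) * z ^ 2 + k * |z| + m)) (Set.Iio 0) := by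
  have hgauss : IntegrableOn (fun z : ℝ => |z| ^ a * exp (-b * z ^ 2)) (Set.Iio 0) := by
    have h0 := (show IntegrableOn (fun z : ℝ => z ^ a * exp (-b * z ^ 2)) (Set.Ioi (-0)) by
      simpa using integrableOn_rpow_mul_exp_neg_mul_sq hb ha).comp_neg_Iio
    refine h0.congr_fun (fun z hz => ?_) measurableSet_Iio
    simp [abs_of_neg (Set.mem_Iio.mp hz)]
  refine (hgauss.mul_const (exp (k ^ 2 / (4 * b) + m))).mono'
    (by fun_prop) (Eventually.of_forall fun z => ?_)
  rw [norm_of_nonneg (by positivity), mul_assoc, ← exp_add]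
  refine mul_le_mul_of_nonneg_left (exp_le_exp.mpr ?_) (by positivity)
  have hsq : k ^ 2 / (4 * b) - k * |z| + b * z ^ 2 = b * (|z| - k / (2 * b)) ^ 2 := by
    rw [← sq_abs z]
    field_simp
    ring
  have : 0 ≤ b * (|z| - k / (2 * b)) ^ 2 := by positivity
  linarith

/-- For a set `s` of negative reals, smoothing a bilateral Laplace transform over `s` from below by
an exponential density multiplies its weight by `ϑ / (ϑ - z)`. -/
theorem setIntegral_Iio_laplace_mul_exp {s : Set ℝ} (hs : MeasurableSet s) (hs0 : s ⊆ Set.Iio 0)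
    {ϑ : ℝ} (hϑ : 0 < ϑ) (h : ℝ → ℝ) (hm : Measurable h) (x : ℝ)
    (hint : IntegrableOn (fun z => h z * exp (-x * z)) s) :
    ∫ u in Set.Iio (0 : ℝ), (∫ z in s, h z * exp (-(x + u) * z)) * ϑ * exp (ϑ * u)
      = ∫ z in s, ϑ / (ϑ - z) * h z * exp (-x * z) := by
  have hexp : IntegrableOn (fun u : ℝ => ϑ * exp (ϑ * u)) (Set.Iio 0) :=
    ((integrableOn_exp_mul_Iic hϑ 0).mono_set Set.Iio_subset_Iic_self).const_mul ϑ
  have hprod : Integrable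
      (Function.uncurry fun u z : ℝ => h z * exp (-(x + u) * z) * (ϑ * exp (ϑ * u)))
      ((volume.restrict (Set.Iio 0)).prod (volume.restrict s)) := by
    refine (hexp.mul_prod hint).mono (by unfold Function.uncurry; fun_prop) ?_
    rw [Measure.prod_restrict]
    filter_upwards [ae_restrict_mem (measurableSet_Iio.prod hs)] with ⟨u, z⟩ ⟨hu, hz⟩
    have hz0 : z < 0 := hs0 hz
    have hu0 : u < 0 := hu
    simp only [Function.uncurry_apply_pair, norm_mul, norm_eq_abs, abs_exp]
    have hle : exp (-(x + u) * z) ≤ exp (-x * z) :=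
      exp_le_exp.mpr (by nlinarith [mul_pos_of_neg_of_neg hu0 hz0])
    rw [mul_comm]
    gcongr
  calc _ = ∫ u in Set.Iio (0 : ℝ), ∫ z in s, h z * exp (-(x + u) * z) * (ϑ * exp (ϑ * u)) := by
        simp only [integral_mul_const, mul_assoc _ ϑ]
    _ = ∫ z in s, ∫ u in Set.Iio (0 : ℝ), h z * exp (-(x + u) * z) * (ϑ * exp (ϑ * u)) :=
        integral_integral_swap hprod
    _ = _ := by
        refine setIntegral_congr_fun hs fun z hz => ?_
        have hz0 : z < 0 := hs0 hz
        have hsplit (u : ℝ) : h z * exp (-(x + u) * z) * (ϑ * exp (ϑ * u))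
            = ϑ * h z * exp (-x * z) * exp ((ϑ - z) * u) := by
          have : exp (-(x + u) * z) * exp (ϑ * u) = exp (-x * z) * exp ((ϑ - z) * u) := by
            rw [← exp_add, ← exp_add]
            ring_nf
          linear_combination ϑ * h z * this
        simp only [hsplit]
        rw [integral_const_mul, ← integral_Iic_eq_integral_Iio,
          integral_exp_mul_Iic (by linarith) 0, mul_zero, exp_zero]
        ring

/-- For `Γ` among `Γ₃=(−η,0)`, `Γ₄=(−∞,−η)` and every `x ∈ ℝ`, the
exponential smoothing of `F^q(x) = ∫_Γ h_q(z) e^{−xz} dz` from below equals the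
kernel-weighted transform:
`∫_{−∞}^0 F^q(x+u) ϑ e^{ϑu} du = ∫_Γ (ϑ/(ϑ−z)) h_q(z) e^{−xz} dz` (i.e. `C^{0,q}(x)`). -/
theorem stmt11 (κ μ σ lam p η ϑ q : ℝ)
    (hκ : 0 < κ) (hσ : 0 < σ) (hlam : 0 < lam) (hp : 0 < p) (hp1 : p < 1)
    (hη : 0 < η) (hϑ : 0 < ϑ) (hq : 0 < q)
    (h : ℝ → ℝ)
    (hdef : ∀ z : ℝ, h z =
      |z| ^ (q / κ - 1) * Real.exp (-σ ^ 2 * z ^ 2 / (4 * κ) + μ * z / κ)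
        * |η + z| ^ (lam * p / κ) * |z - ϑ| ^ (lam * (1 - p) / κ)) :
    ∀ Γ ∈ ({Set.Ioo (-η) 0, Set.Iio (-η)} : Set (Set ℝ)), ∀ x : ℝ,
      ∫ u in Set.Iio (0 : ℝ),
          (∫ z in Γ, h z * Real.exp (-(x + u) * z)) * ϑ * Real.exp (ϑ * u)
        = ∫ z in Γ, ϑ / (ϑ - z) * h z * Real.exp (-x * z) := by
  intro Γ hΓ x
  have hΓm : MeasurableSet Γ := by
    rcases hΓ with rfl | rfl
    exacts [measurableSet_Ioo, measurableSet_Iio]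
  have hΓ0 : Γ ⊆ Set.Iio 0 := by
    rcases hΓ with rfl | rfl
    · exact Set.Ioo_subset_Iio_self
    · exact Set.Iio_subset_Iio (by linarith)
  have hm : Measurable h := by
    rw [funext hdef]
    fun_prop
  refine setIntegral_Iio_laplace_mul_exp hΓm hΓ0 hϑ h hm x (IntegrableOn.mono_set ?_ hΓ0)
  have hα : 0 ≤ lam * p / κ := by positivity
  have hβ : 0 ≤ lam * (1 - p) / κ := by
    have := sub_pos.mpr hp1
    positivity
  have ha : -1 < q / κ - 1 := by linarith [div_pos hq hκ]
  have hb : 0 < σ ^ 2 / (8 * κ) := by positivity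
  refine (integrableOn_Iio_abs_rpow_mul_exp_quadratic ha hb
    (-μ / κ + x + lam * p / κ + lam * (1 - p) / κ)
    (lam * p / κ * η + lam * (1 - p) / κ * ϑ)).mono' (by fun_prop) ?_
  filter_upwards [ae_restrict_mem measurableSet_Iio] with z hz
  have hz0 : |z| = -z := abs_of_neg hz
  have h1 := abs_add_rpow_le_exp η z hη.le hα
  have h2 := abs_add_rpow_le_exp ϑ (-z) hϑ.le hβ
  rw [← sub_eq_add_neg, abs_sub_comm, abs_neg] at h2
  rw [hdef, norm_of_nonneg (by positivity)]
  calc _ ≤ |z| ^ (q / κ - 1) * exp (-σ ^ 2 * z ^ 2 / (4 * κ) + μ * z / κ)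
        * exp (lam * p / κ * (η + |z|)) * exp (lam * (1 - p) / κ * (ϑ + |z|)) * exp (-x * z) := by
        gcongr
    _ = _ := by
        simp only [mul_assoc, ← exp_add]
        rw [hz0]
        congr 2
        field_simp
        ring
end

section
/- The functions L₁ and L₂ are finite, strictly positive and twice differentiable on all of ℝ, and each L ∈ {L₁, L₂} satisfies the Ornstein–Uhlenbeck eigenvalue equation (μ − κx)·L′(x) + (σ²/2)·L″(x) − q·L(x) = 0 for every x ∈ ℝ. -/
open Real MeasureTheory Filter Topology

/-- The moment `∫₀^∞ z ^ s * exp (-b * z ^ 2 + c * z) dz` of a half-line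
Gaussian weight. -/
noncomputable def gaussianMoment (s b c : ℝ) : ℝ :=
  ∫ z in Set.Ioi (0 : ℝ), z ^ s * Real.exp (-b * z ^ 2 + c * z)

theorem integrableOn_rpow_mul_exp_quadratic {s b : ℝ} (hs : -1 < s) (hb : 0 < b) (c : ℝ) :
    IntegrableOn (fun z : ℝ => z ^ s * Real.exp (-b * z ^ 2 + c * z)) (Set.Ioi 0) := by
  have hdom : IntegrableOn (fun z : ℝ => Real.exp (c ^ 2 / (2 * b)) *
      (z ^ s * Real.exp (-(b / 2) * z ^ 2))) (Set.Ioi 0) :=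
    (integrableOn_rpow_mul_exp_neg_mul_sq (half_pos hb) hs).const_mul _
  refine Integrable.mono' hdom (by fun_prop) ?_
  filter_upwards [ae_restrict_mem measurableSet_Ioi] with z hz
  have hz' : 0 < z := hz
  rw [Real.norm_of_nonneg (by positivity), mul_left_comm, ← Real.exp_add]
  refine mul_le_mul_of_nonneg_left (Real.exp_le_exp.2 ?_) (by positivity)
  have h : c ^ 2 / (2 * b) + -(b / 2) * z ^ 2 - (-b * z ^ 2 + c * z)
      = (c - b * z) ^ 2 / (2 * b) := by
    field_simp
    ring
  have h' : 0 ≤ (c - b * z) ^ 2 / (2 * b) := by positivity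
  linarith

theorem gaussianMoment_pos {s b : ℝ} (hs : -1 < s) (hb : 0 < b) (c : ℝ) :
    0 < gaussianMoment s b c := by
  have hpos : ∀ z ∈ Set.Ioi (0 : ℝ), 0 < z ^ s * Real.exp (-b * z ^ 2 + c * z) := by
    intro z hz
    have hz' : 0 < z := hz
    positivity
  rw [gaussianMoment, setIntegral_pos_iff_support_of_nonneg_ae
    ((ae_restrict_mem measurableSet_Ioi).mono fun z hz => (hpos z hz).le)
    (integrableOn_rpow_mul_exp_quadratic hs hb c),
    Set.inter_eq_right.2 fun z hz => Function.mem_support.2 (hpos z hz).ne']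
  simp

theorem hasDerivAt_gaussianMoment {s b : ℝ} (hs : -1 < s) (hb : 0 < b) (c : ℝ) :
    HasDerivAt (gaussianMoment s b) (gaussianMoment (s + 1) b c) c := by
  refine (hasDerivAt_integral_of_dominated_loc_of_deriv_le
    (F := fun c z : ℝ => z ^ s * Real.exp (-b * z ^ 2 + c * z))
    (F' := fun c z : ℝ => z ^ (s + 1) * Real.exp (-b * z ^ 2 + c * z))
    (bound := fun z : ℝ => z ^ (s + 1) * Real.exp (-b * z ^ 2 + (c + 1) * z))
    (Iio_mem_nhds (lt_add_one c)) (Eventually.of_forall fun _ => by fun_prop)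
    (integrableOn_rpow_mul_exp_quadratic hs hb c) (by fun_prop) ?_
    (integrableOn_rpow_mul_exp_quadratic (by linarith) hb (c + 1)) ?_).2
  · filter_upwards [ae_restrict_mem measurableSet_Ioi] with z hz x hx
    have hz' : 0 < z := hz
    have hx' : x < c + 1 := hx
    rw [Real.norm_of_nonneg (by positivity)]
    gcongr
  · filter_upwards [ae_restrict_mem measurableSet_Ioi] with z hz x _
    have hlin : HasDerivAt (fun c : ℝ => -b * z ^ 2 + c * z) z x := by
      simpa using ((hasDerivAt_id x).mul_const z).const_add (-b * z ^ 2)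
    convert! hlin.exp.const_mul (z ^ s) using 1
    rw [Real.rpow_add_one (ne_of_gt hz)]
    ring

theorem gaussianMoment_recurrence {s b : ℝ} (hs : -1 < s) (hb : 0 < b) (c : ℝ) :
    (s + 1) * gaussianMoment s b c + c * gaussianMoment (s + 1) b c
      - 2 * b * gaussianMoment (s + 1 + 1) b c = 0 := by
  have h₀ := (integrableOn_rpow_mul_exp_quadratic hs hb c).const_mul (s + 1)
  have h₁ := (integrableOn_rpow_mul_exp_quadratic (s := s + 1) (by linarith) hb c)
  have h₂ := (integrableOn_rpow_mul_exp_quadratic (s := s + 1 + 1) (by linarith) hb c).const_mul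
    (2 * b)
  have hderiv : ∀ z ∈ Set.Ioi (0 : ℝ),
      HasDerivAt (fun z : ℝ => z ^ (s + 1) * Real.exp (-b * z ^ 2 + c * z))
        ((s + 1) * (z ^ s * Real.exp (-b * z ^ 2 + c * z))
          + c * (z ^ (s + 1) * Real.exp (-b * z ^ 2 + c * z))
          - 2 * b * (z ^ (s + 1 + 1) * Real.exp (-b * z ^ 2 + c * z))) z := by
    intro z hz
    have hz' : z ≠ 0 := ne_of_gt hz
    have hquad : HasDerivAt (fun z : ℝ => -b * z ^ 2 + c * z) (-b * (2 * z) + c) z := by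
      simpa using ((hasDerivAt_pow 2 z).const_mul (-b)).fun_add ((hasDerivAt_id z).const_mul c)
    convert! (Real.hasDerivAt_rpow_const (p := s + 1) (Or.inl hz')).mul hquad.exp using 1
    rw [Real.rpow_add_one hz' (s + 1), add_sub_cancel_right]
    ring
  have hint := (h₀.add (h₁.const_mul c)).sub h₂
  have hcont : ContinuousWithinAt (fun z : ℝ => z ^ (s + 1) * Real.exp (-b * z ^ 2 + c * z))
      (Set.Ici 0) 0 :=
    ((Real.continuousAt_rpow_const 0 (s + 1) (Or.inr (by linarith))).mul
      (by fun_prop)).continuousWithinAt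
  have hFTC := integral_Ioi_of_hasDerivAt_of_tendsto hcont hderiv hint
    (tendsto_zero_of_hasDerivAt_of_integrableOn_Ioi hderiv hint h₁)
  rw [integral_sub (by exact h₀.add (h₁.const_mul c)) h₂,
    integral_add h₀ (h₁.const_mul c)] at hFTC
  simp only [integral_const_mul, Real.zero_rpow (show s + 1 ≠ 0 by linarith), zero_mul,
    sub_zero] at hFTC
  exact hFTC

/-- Affine reparametrisations of the Gaussian moments are twice differentiable and solve the
Ornstein–Uhlenbeck eigenvalue equation. -/
theorem ornsteinUhlenbeck_of_eq_gaussianMoment {κ μ σ q ε : ℝ} (hκ : 0 < κ) (hσ : 0 < σ)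
    (hq : 0 < q) (hε : ε ^ 2 = 1) {L : ℝ → ℝ}
    (hL : ∀ x, L x = gaussianMoment (q / κ - 1) (σ ^ 2 / (4 * κ)) (ε * (μ / κ - x))) :
    (∀ x, 0 < L x) ∧ (Differentiable ℝ L ∧ Differentiable ℝ (deriv L)) ∧
      ∀ x, (μ - κ * x) * deriv L x + σ ^ 2 / 2 * deriv (deriv L) x - q * L x = 0 := by
  have hs : -1 < q / κ - 1 := by linarith [div_pos hq hκ]
  have hb : 0 < σ ^ 2 / (4 * κ) := by positivity
  have hlin : ∀ x : ℝ, HasDerivAt (fun x => ε * (μ / κ - x)) (-ε) x := fun x => by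
    simpa using ((hasDerivAt_id x).const_sub (μ / κ)).const_mul ε
  have hcomp : ∀ s : ℝ, -1 < s → ∀ x : ℝ,
      HasDerivAt (fun x => gaussianMoment s (σ ^ 2 / (4 * κ)) (ε * (μ / κ - x)))
        (gaussianMoment (s + 1) (σ ^ 2 / (4 * κ)) (ε * (μ / κ - x)) * -ε) x := fun s hs x =>
    (hasDerivAt_gaussianMoment hs hb _).comp x (hlin x)
  have hL₁ := hcomp _ hs
  rw [← funext hL] at hL₁
  have hL₂ := fun x => (hcomp (q / κ - 1 + 1) (by linarith) x).mul_const (-ε)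
  rw [← funext fun x => (hL₁ x).deriv] at hL₂
  refine ⟨fun x => hL x ▸ gaussianMoment_pos hs hb _, ⟨fun x => (hL₁ x).differentiableAt,
    fun x => (hL₂ x).differentiableAt⟩, fun x => ?_⟩
  have hrec := gaussianMoment_recurrence hs hb (ε * (μ / κ - x))
  rw [(hL₁ x).deriv, (hL₂ x).deriv, hL x]
  generalize gaussianMoment (q / κ - 1 + 1 + 1) _ _ = A at *
  generalize gaussianMoment (q / κ - 1 + 1) _ _ = B at *
  generalize gaussianMoment (q / κ - 1) _ _ = C at *
  field_simp at hrec
  linear_combination (-1 / 4 : ℝ) * hrec + σ ^ 2 / 2 * A * hε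

/-- The functions `L₁(x) = ∫_0^∞ z^{q/κ−1} e^{−σ²z²/(4κ)+μz/κ} e^{−xz} dz`
and `L₂(x) = ∫_{−∞}^0 |z|^{q/κ−1} e^{−σ²z²/(4κ)+μz/κ} e^{−xz} dz` are finite (the
integrands are integrable), strictly positive and twice differentiable on all of `ℝ`,
and both satisfy the OU eigenvalue equation
`(μ − κx) L'(x) + (σ²/2) L''(x) − q L(x) = 0` for every `x`. -/
theorem stmt12 (κ μ σ q : ℝ) (hκ : 0 < κ) (hσ : 0 < σ) (hq : 0 < q)
    (L₁ L₂ : ℝ → ℝ)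
    (hL₁ : ∀ x : ℝ, L₁ x = ∫ z in Set.Ioi (0 : ℝ),
      z ^ (q / κ - 1) * Real.exp (-σ ^ 2 * z ^ 2 / (4 * κ) + μ * z / κ)
        * Real.exp (-x * z))
    (hL₂ : ∀ x : ℝ, L₂ x = ∫ z in Set.Iio (0 : ℝ),
      |z| ^ (q / κ - 1) * Real.exp (-σ ^ 2 * z ^ 2 / (4 * κ) + μ * z / κ)
        * Real.exp (-x * z)) :
    (∀ x : ℝ, MeasureTheory.IntegrableOn
      (fun z : ℝ => z ^ (q / κ - 1) * Real.exp (-σ ^ 2 * z ^ 2 / (4 * κ) + μ * z / κ)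
        * Real.exp (-x * z)) (Set.Ioi (0 : ℝ))) ∧
    (∀ x : ℝ, MeasureTheory.IntegrableOn
      (fun z : ℝ => |z| ^ (q / κ - 1) * Real.exp (-σ ^ 2 * z ^ 2 / (4 * κ) + μ * z / κ)
        * Real.exp (-x * z)) (Set.Iio (0 : ℝ))) ∧
    (∀ x : ℝ, 0 < L₁ x ∧ 0 < L₂ x) ∧
    (Differentiable ℝ L₁ ∧ Differentiable ℝ (deriv L₁)) ∧
    (Differentiable ℝ L₂ ∧ Differentiable ℝ (deriv L₂)) ∧
    (∀ x : ℝ,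
      (μ - κ * x) * deriv L₁ x + σ ^ 2 / 2 * deriv (deriv L₁) x - q * L₁ x = 0 ∧
      (μ - κ * x) * deriv L₂ x + σ ^ 2 / 2 * deriv (deriv L₂) x - q * L₂ x = 0) := by
  have hint := integrableOn_rpow_mul_exp_quadratic (s := q / κ - 1) (b := σ ^ 2 / (4 * κ))
    (by linarith [div_pos hq hκ]) (by positivity)
  have hI₁ : ∀ x z : ℝ, z ^ (q / κ - 1) *
      Real.exp (-σ ^ 2 * z ^ 2 / (4 * κ) + μ * z / κ) * Real.exp (-x * z)
      = z ^ (q / κ - 1) * Real.exp (-(σ ^ 2 / (4 * κ)) * z ^ 2 + 1 * (μ / κ - x) * z) := by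
    intro x z
    rw [mul_assoc, ← Real.exp_add]
    congr 2
    ring
  have hI₂ : ∀ x : ℝ, ∀ z ∈ Set.Ioi (0 : ℝ), |(-z)| ^ (q / κ - 1) *
      Real.exp (-σ ^ 2 * (-z) ^ 2 / (4 * κ) + μ * (-z) / κ) * Real.exp (-x * (-z))
      = z ^ (q / κ - 1) * Real.exp (-(σ ^ 2 / (4 * κ)) * z ^ 2 + -1 * (μ / κ - x) * z) := by
    intro x z hz
    rw [abs_neg, abs_of_pos hz, mul_assoc, ← Real.exp_add]
    congr 2
    ring
  have hM₁ : ∀ x, L₁ x = gaussianMoment (q / κ - 1) (σ ^ 2 / (4 * κ)) (1 * (μ / κ - x)) := by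
    intro x
    simp only [hL₁, hI₁, gaussianMoment]
  have hM₂ : ∀ x, L₂ x = gaussianMoment (q / κ - 1) (σ ^ 2 / (4 * κ)) (-1 * (μ / κ - x)) := by
    intro x
    rw [hL₂, gaussianMoment, ← setIntegral_congr_fun measurableSet_Ioi (hI₂ x),
      integral_comp_neg_Ioi 0 (fun z : ℝ => |z| ^ (q / κ - 1) *
        Real.exp (-σ ^ 2 * z ^ 2 / (4 * κ) + μ * z / κ) * Real.exp (-x * z)), neg_zero,
      integral_Iic_eq_integral_Iio]
  obtain ⟨hpos₁, hdiff₁, hode₁⟩ :=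
    ornsteinUhlenbeck_of_eq_gaussianMoment hκ hσ hq (by norm_num) hM₁
  obtain ⟨hpos₂, hdiff₂, hode₂⟩ :=
    ornsteinUhlenbeck_of_eq_gaussianMoment hκ hσ hq (by norm_num) hM₂
  refine ⟨fun x => ?_, fun x => ?_, fun x => ⟨hpos₁ x, hpos₂ x⟩, hdiff₁, hdiff₂,
    fun x => ⟨hode₁ x, hode₂ x⟩⟩
  · simpa only [hI₁] using hint (1 * (μ / κ - x))
  · rw [← (Measure.measurePreserving_neg volume).integrableOn_comp_preimage
      (MeasurableEquiv.neg ℝ).measurableEmbedding,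
      show (Neg.neg ⁻¹' Set.Iio 0 : Set ℝ) = Set.Ioi 0 by ext; simp]
    exact (integrableOn_congr_fun (hI₂ x) measurableSet_Ioi).2 (hint _)
end

section
/- Fix b ∈ ℝ. Then lim_{ε↓0} ( 1 − P_up(ε) − P_down(ε) )/ε² = ( L₁″(b)L₂′(b) − L₁′(b)L₂″(b) ) / ( 2·( L₁(b)L₂′(b) − L₂(b)L₁′(b) ) ). -/
open Real MeasureTheory Filter Topology

open ProbabilityTheory in
/-- The moment generating function of an almost surely positive variable is strictly increasing. -/
lemma deriv_mgf_pos {Ω : Type*} [MeasurableSpace Ω] {ν : Measure Ω} {X : Ω → ℝ} {t : ℝ}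
    (hν : ν ≠ 0) (hX : ∀ᵐ ω ∂ν, 0 < X ω) (ht : t ∈ interior (integrableExpSet X ν)) :
    0 < deriv (mgf X ν) t := by
  have hpos : ∀ᵐ ω ∂ν, 0 < X ω * exp (t * X ω) := by
    filter_upwards [hX] with ω hω using by positivity
  have hint : Integrable (fun ω ↦ X ω * exp (t * X ω)) ν := by
    simpa using integrable_pow_mul_exp_of_mem_interior_integrableExpSet ht 1
  rw [deriv_mgf ht]
  refine (integral_nonneg_of_ae (hpos.mono fun _ h ↦ h.le)).lt_of_ne fun h0 ↦ hν ?_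
  have hzero := (integral_eq_zero_iff_of_nonneg_ae (hpos.mono fun _ h ↦ h.le) hint).1 h0.symm
  refine ae_eq_bot.1 (eventually_false_iff_eq_bot.1 ?_)
  filter_upwards [hpos, hzero] with ω h1 h2 using h1.ne' h2

lemma integrable_rpow_mul_exp_quadratic {s a c : ℝ} (hs : 0 < s) (ha : 0 < a) :
    IntegrableOn (fun z : ℝ ↦ z ^ (s - 1) * exp (-a * z ^ 2 + c * z)) (Set.Ioi 0) := by
  have hdom := ((integrable_rpow_mul_exp_neg_mul_sq (half_pos ha)
    (s := s - 1) (by linarith)).const_mul (exp (c ^ 2 / (2 * a)))).integrableOn (s := Set.Ioi 0)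
  refine hdom.mono' (by fun_prop) ?_
  filter_upwards [ae_restrict_mem measurableSet_Ioi] with z (hz : 0 < z)
  have hzs : 0 < z ^ (s - 1) := rpow_pos_of_pos hz _
  rw [norm_of_nonneg (by positivity), mul_left_comm, ← exp_add]
  refine mul_le_mul_of_nonneg_left (exp_le_exp.2 ?_) hzs.le
  have : c ^ 2 / (2 * a) + -(a / 2) * z ^ 2 - (-a * z ^ 2 + c * z) = (c - a * z) ^ 2 / (2 * a) := by
    field_simp
    ring
  have : 0 ≤ (c - a * z) ^ 2 / (2 * a) := by positivity
  linarith

open ProbabilityTheory in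
/-- The exponential transform of a Gaussian-damped power on the half-line is entire,
positive and increasing. -/
lemma rpow_mul_exp_quadratic_transform {s a c : ℝ} (hs : 0 < s) (ha : 0 < a) {F : ℝ → ℝ}
    (hF : ∀ t, F t = ∫ z in Set.Ioi (0 : ℝ), z ^ (s - 1) * exp (-a * z ^ 2 + c * z) * exp (t * z)) :
    AnalyticOnNhd ℝ F Set.univ ∧ ∀ t, 0 < F t ∧ 0 < deriv F t := by
  set g : ℝ → ℝ := fun z ↦ z ^ (s - 1) * exp (-a * z ^ 2 + c * z) with hg
  have hgm : Measurable g := by fun_prop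
  have hgpos : ∀ z ∈ Set.Ioi (0 : ℝ), 0 < g z := fun z hz ↦
    mul_pos (rpow_pos_of_pos hz _) (exp_pos _)
  set ν : Measure ℝ := (volume.restrict (Set.Ioi 0)).withDensity (fun z ↦ ENNReal.ofReal (g z))
    with hνdef
  have hint (t : ℝ) : Integrable (fun z : ℝ ↦ exp (t * z)) ν := by
    rw [hνdef, integrable_withDensity_iff hgm.ennreal_ofReal (by simp)]
    refine (integrable_rpow_mul_exp_quadratic (c := c + t) hs ha).congr_fun (fun z hz ↦ ?_)
      measurableSet_Ioi
    rw [ENNReal.toReal_ofReal (hgpos z hz).le]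
    simp only [hg]
    rw [mul_comm (exp _), mul_assoc, ← exp_add]
    ring_nf
  have hset : interior (integrableExpSet id ν) = Set.univ := by
    rw [interior_eq_univ]
    exact Set.eq_univ_of_forall hint
  have hFν : F = mgf id ν := by
    ext t
    rw [hF, mgf, hνdef, integral_withDensity_eq_integral_toReal_smul hgm.ennreal_ofReal (by simp)]
    refine setIntegral_congr_fun measurableSet_Ioi fun z hz ↦ ?_
    rw [ENNReal.toReal_ofReal (hgpos z hz).le, smul_eq_mul, id]
  have hν : ν ≠ 0 := by
    rw [hνdef, Ne, withDensity_eq_zero_iff hgm.ennreal_ofReal.aemeasurable]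
    intro h
    have h0 : ∀ᵐ z ∂(volume.restrict (Set.Ioi (0 : ℝ))), False := by
      filter_upwards [h, ae_restrict_mem measurableSet_Ioi] with z h1 h2
      exact (ENNReal.ofReal_pos.2 (hgpos z h2)).ne' h1
    have h1 := ae_iff.1 h0
    simp at h1
  have hpos : ∀ᵐ z ∂ν, 0 < id z :=
    (withDensity_absolutelyContinuous _ _).ae_le (ae_restrict_mem measurableSet_Ioi)
  rw [hFν]
  refine ⟨hset ▸ analyticOnNhd_mgf, fun t ↦ ⟨mgf_pos' hν (hint t), ?_⟩⟩
  exact deriv_mgf_pos hν hpos (hset ▸ Set.mem_univ t)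

lemma tendsto_symmetric_second_difference {f : ℝ → ℝ} {b : ℝ} (hf : Differentiable ℝ f)
    (hf' : DifferentiableAt ℝ (deriv f) b) :
    Tendsto (fun ε ↦ (f (b + ε) + f (b - ε) - 2 * f b) / ε ^ 2) (𝓝[>] 0)
      (𝓝 (deriv (deriv f) b)) := by
  have hplus (ε : ℝ) : HasDerivAt (fun ε ↦ f (b + ε)) (deriv f (b + ε)) ε :=
    (hf _).hasDerivAt.comp_const_add b ε
  have hminus (ε : ℝ) : HasDerivAt (fun ε ↦ f (b - ε)) (-deriv f (b - ε)) ε :=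
    (hf _).hasDerivAt.comp_const_sub b ε
  have hcont : Continuous (fun ε ↦ f (b + ε) + f (b - ε) - 2 * f b) := by
    have := hf.continuous
    fun_prop
  refine HasDerivAt.lhopital_zero_nhdsGT
    (f' := fun ε ↦ deriv f (b + ε) - deriv f (b - ε)) (g' := fun ε ↦ 2 * ε) ?_ ?_ ?_ ?_ ?_ ?_
  · exact .of_forall fun ε ↦ ((hplus ε).add (hminus ε)).sub_const _
  · exact .of_forall fun ε ↦ by simpa using hasDerivAt_pow 2 ε
  · filter_upwards [self_mem_nhdsWithin] with ε (hε : 0 < ε) using by positivity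
  · refine tendsto_nhdsWithin_of_tendsto_nhds ?_
    convert! hcont.tendsto 0 using 2
    ring_nf
  · refine tendsto_nhdsWithin_of_tendsto_nhds ?_
    simpa using (continuous_pow 2).tendsto (0 : ℝ)
  · have h1 : HasDerivAt (fun ε ↦ deriv f (b + ε)) (deriv (deriv f) b) 0 :=
      HasDerivAt.comp_const_add b 0 (by simpa using hf'.hasDerivAt)
    have h2 : HasDerivAt (fun ε ↦ deriv f (b - ε)) (-deriv (deriv f) b) 0 :=
      HasDerivAt.comp_const_sub b 0 (by simpa using hf'.hasDerivAt)
    have h := ((h1.sub h2).tendsto_slope_zero_right).const_mul (1 / 2)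
    convert! h using 2 with ε
    · simp only [zero_add, Pi.sub_apply, add_zero, sub_zero, sub_self, smul_eq_mul]
      ring
    · ring

/-- Second-order expansion of the exit probabilities built from two solutions `f`, `g` with
nonzero Wronskian at `b`. -/
lemma tendsto_one_sub_exit_probabilities {f g : ℝ → ℝ} {b : ℝ}
    (hf : Differentiable ℝ f) (hf' : DifferentiableAt ℝ (deriv f) b)
    (hg : Differentiable ℝ g) (hg' : DifferentiableAt ℝ (deriv g) b)
    (hfg : f b * deriv g b - g b * deriv f b ≠ 0) {W : ℝ → ℝ}
    (hW : ∀ ε, W ε = f (b + ε) * g (b - ε) - g (b + ε) * f (b - ε)) :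
    Tendsto (fun ε ↦ (1 - (f b * g (b - ε) - g b * f (b - ε)) / W ε
        - (g b * f (b + ε) - f b * g (b + ε)) / W ε) / ε ^ 2) (𝓝[>] 0)
      (𝓝 ((deriv (deriv f) b * deriv g b - deriv f b * deriv (deriv g) b)
        / (2 * (f b * deriv g b - g b * deriv f b)))) := by
  have slope {h : ℝ → ℝ} (hh : Differentiable ℝ h) :
      Tendsto (fun ε ↦ ε⁻¹ * (h (b + ε) - h b)) (𝓝[>] 0) (𝓝 (deriv h b)) :=
    (hh b).hasDerivAt.tendsto_slope_zero_right
  have hN := ((slope hf).mul (tendsto_symmetric_second_difference hg hg')).sub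
    ((slope hg).mul (tendsto_symmetric_second_difference hf hf'))
  have hWderiv : HasDerivAt W (-2 * (f b * deriv g b - g b * deriv f b)) 0 := by
    have plus {h : ℝ → ℝ} (hh : Differentiable ℝ h) :
        HasDerivAt (fun ε ↦ h (b + ε)) (deriv h b) 0 :=
      HasDerivAt.comp_const_add b 0 (by simpa using (hh b).hasDerivAt)
    have minus {h : ℝ → ℝ} (hh : Differentiable ℝ h) :
        HasDerivAt (fun ε ↦ h (b - ε)) (-deriv h b) 0 :=
      HasDerivAt.comp_const_sub b 0 (by simpa using (hh b).hasDerivAt)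
    rw [funext hW]
    convert! ((plus hf).mul (minus hg)).sub ((plus hg).mul (minus hf)) using 1
    simp only [add_zero, sub_zero]
    ring
  have hWslope := hWderiv.tendsto_slope_zero_right
  have hW0 : W 0 = 0 := by
    rw [hW]
    simp [mul_comm]
  simp only [zero_add, hW0, sub_zero, smul_eq_mul] at hWslope
  have hlim : -2 * (f b * deriv g b - g b * deriv f b) ≠ 0 := mul_ne_zero (by norm_num) hfg
  have hquot := hN.div hWslope hlim
  have hval : (deriv (deriv f) b * deriv g b - deriv f b * deriv (deriv g) b)
      / (2 * (f b * deriv g b - g b * deriv f b))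
      = (deriv f b * deriv (deriv g) b - deriv g b * deriv (deriv f) b)
        / (-2 * (f b * deriv g b - g b * deriv f b)) := by
    rw [neg_mul, div_neg, ← neg_div]
    ring
  rw [hval]
  refine hquot.congr' ?_
  filter_upwards [self_mem_nhdsWithin, hWslope.eventually_ne hlim] with ε (hε : 0 < ε) hWε
  have hWne : W ε ≠ 0 := right_ne_zero_of_mul hWε
  simp only [Pi.div_apply]
  field_simp
  rw [hW]
  ring

/-- With `W(ε) = L₁(b+ε)L₂(b−ε) − L₂(b+ε)L₁(b−ε)`,
`P_up(ε) = (L₁(b)L₂(b−ε) − L₂(b)L₁(b−ε))/W(ε)` and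
`P_down(ε) = (L₂(b)L₁(b+ε) − L₁(b)L₂(b+ε))/W(ε)`, we have
`lim_{ε↓0} (1 − P_up(ε) − P_down(ε))/ε² =
  (L₁''(b)L₂'(b) − L₁'(b)L₂''(b)) / (2(L₁(b)L₂'(b) − L₂(b)L₁'(b)))`. -/
theorem stmt15 (κ μ σ q b : ℝ) (hκ : 0 < κ) (hσ : 0 < σ) (hq : 0 < q)
    (L₁ L₂ : ℝ → ℝ)
    (hL₁ : ∀ x : ℝ, L₁ x = ∫ z in Set.Ioi (0 : ℝ),
      z ^ (q / κ - 1) * Real.exp (-σ ^ 2 * z ^ 2 / (4 * κ) + μ * z / κ)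
        * Real.exp (-x * z))
    (hL₂ : ∀ x : ℝ, L₂ x = ∫ z in Set.Iio (0 : ℝ),
      |z| ^ (q / κ - 1) * Real.exp (-σ ^ 2 * z ^ 2 / (4 * κ) + μ * z / κ)
        * Real.exp (-x * z))
    (W Pup Pdown : ℝ → ℝ)
    (hW : ∀ ε : ℝ, W ε = L₁ (b + ε) * L₂ (b - ε) - L₂ (b + ε) * L₁ (b - ε))
    (hPup : ∀ ε : ℝ, Pup ε = (L₁ b * L₂ (b - ε) - L₂ b * L₁ (b - ε)) / W ε)
    (hPdown : ∀ ε : ℝ, Pdown ε = (L₂ b * L₁ (b + ε) - L₁ b * L₂ (b + ε)) / W ε) :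
    Tendsto (fun ε : ℝ => (1 - Pup ε - Pdown ε) / ε ^ 2) (𝓝[>] 0)
      (𝓝 ((deriv (deriv L₁) b * deriv L₂ b - deriv L₁ b * deriv (deriv L₂) b)
        / (2 * (L₁ b * deriv L₂ b - L₂ b * deriv L₁ b)))) := by
  have hs : 0 < q / κ := by positivity
  have ha : 0 < σ ^ 2 / (4 * κ) := by positivity
  obtain ⟨hA₁, hpos₁⟩ := rpow_mul_exp_quadratic_transform (c := μ / κ) hs ha
    (F := fun t ↦ L₁ (-t)) fun t ↦ by
      rw [hL₁]
      congr! 6 <;> ring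
  obtain ⟨hA₂, hpos₂⟩ := rpow_mul_exp_quadratic_transform (c := -μ / κ) hs ha
    (F := L₂) fun t ↦ by
      rw [hL₂, ← integral_Iic_eq_integral_Iio, ← neg_zero (G := ℝ), ← integral_comp_neg_Ioi,
        neg_zero]
      refine setIntegral_congr_fun measurableSet_Ioi fun z (hz : 0 < z) ↦ ?_
      simp only [abs_neg, abs_of_pos hz]
      congr 1
      · congr 2
        ring
      · congr 1
        ring
  have hA₁' : AnalyticOnNhd ℝ L₁ Set.univ := by
    have : L₁ = (fun t ↦ L₁ (-t)) ∘ Neg.neg := by ext; simp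
    rw [this]
    exact hA₁.comp analyticOnNhd_id.neg (Set.mapsTo_univ _ _)
  have hd₁ : deriv L₁ b < 0 := by
    have := (hpos₁ (-b)).2
    rw [deriv_comp_neg] at this
    simpa using this
  have hp₁ : 0 < L₁ b := by simpa using (hpos₁ (-b)).1
  have hne : L₁ b * deriv L₂ b - L₂ b * deriv L₁ b ≠ 0 := by
    have := mul_pos hp₁ (hpos₂ b).2
    have := mul_neg_of_pos_of_neg (hpos₂ b).1 hd₁
    linarith
  simp only [hPup, hPdown]
  exact tendsto_one_sub_exit_probabilities
    (fun x ↦ (hA₁' x trivial).differentiableAt) (hA₁'.deriv b trivial).differentiableAt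
    (fun x ↦ (hA₂ x trivial).differentiableAt) (hA₂.deriv b trivial).differentiableAt hne hW
end
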